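/- The generating function identity T(x,y) = H(T(x), y) + T(x²)y²/2 + xy holds, where T(x,y) = Σ_{planar tanglegrams 𝒯} x^{|𝒯|} y^{|irr(𝒯)|}, T(x) = T(x,1), and H(x,y) = H(xy) with H(x) = x²/2 + Σ_{irreducible planar tanglegrams 𝒯 with |𝒯|>2} x^{|𝒯|}. -/

import Mathlib

/-- A rooted binary tree with leaves labeled by `α` (the plane structure is
quotiented away below via the isomorphism relation, which allows swapping
children). -/
inductive LTree (α : Type) : Type
  | leaf (a : α) : LTree α
  | node (l r : LTree α) : LTree α

/-- The list of leaf labels, from top to bottom in a layout. -/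
def LTree.leafList {α : Type} : LTree α → List α
  | .leaf a => [a]
  | .node l r => l.leafList ++ r.leafList

/-- The finite set of leaf labels. -/
def LTree.leafFinset {α : Type} [DecidableEq α] (t : LTree α) : Finset α :=
  t.leafList.toFinset

/-- `TreeRel f t t'` : `t'` is obtained from `t` by relabeling leaves along
`f` and reordering children arbitrarily (tree isomorphism of rooted binary
trees with unordered children). -/
inductive TreeRel {α β : Type} (f : α → β) : LTree α → LTree β → Prop
  | leaf (a : α) : TreeRel f (.leaf a) (.leaf (f a))
  | node {l r : LTree α} {l' r' : LTree β} :
      TreeRel f l l' → TreeRel f r r' → TreeRel f (.node l r) (.node l' r')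
  | swap {l r : LTree α} {l' r' : LTree β} :
      TreeRel f l r' → TreeRel f r l' → TreeRel f (.node l r) (.node l' r')

/-- Isomorphism of tanglegram representations: an injective relabeling of the
leaf labels carrying both trees to both trees (with children unordered).
A tanglegram of size `n` is represented as a pair of binary trees whose
leaves are labeled bijectively by `Fin n`; the perfect matching joins
equally-labeled leaves. -/
def PairIso {α β : Type} (p : LTree α × LTree α) (q : LTree β × LTree β) : Prop :=
  ∃ f : α → β, Function.Injective f ∧ TreeRel f p.1 q.1 ∧ TreeRel f p.2 q.2

/-- A valid tanglegram representation of size `n`: each label occurs exactly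
once in each tree. -/
def ValidPair (n : ℕ) (p : LTree (Fin n) × LTree (Fin n)) : Prop :=
  p.1.leafList.Perm (List.finRange n) ∧ p.2.leafList.Perm (List.finRange n)

/-- A tanglegram is planar when some isomorphic representative has identical
top-to-bottom leaf sequences in the two trees (a crossing-free layout). -/
def PlanarPair (n : ℕ) (p : LTree (Fin n) × LTree (Fin n)) : Prop :=
  ∃ q : LTree (Fin n) × LTree (Fin n), PairIso p q ∧ q.1.leafList = q.2.leafList

/-- `IsSub u t` : `u` is a subtree of `t`. -/
inductive IsSub {α : Type} : LTree α → LTree α → Prop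
  | refl (t : LTree α) : IsSub t t
  | left {u l : LTree α} (r : LTree α) : IsSub u l → IsSub u (.node l r)
  | right (l : LTree α) {u r : LTree α} : IsSub u r → IsSub u (.node l r)

/-- A block of a tanglegram representation: a set of labels that is the leaf
set of a subtree of both trees (the roots of a matched subtree pair). -/
def IsBlock (n : ℕ) (p : LTree (Fin n) × LTree (Fin n)) (B : Finset (Fin n)) : Prop :=
  (∃ u, IsSub u p.1 ∧ u.leafFinset = B) ∧ ∃ v, IsSub v p.2 ∧ v.leafFinset = B

/-- A proper block: a block that is not the full leaf set. Proper blocks with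
at least two elements correspond exactly to proper subtanglegrams. -/
def ProperBlock (n : ℕ) (p : LTree (Fin n) × LTree (Fin n)) (B : Finset (Fin n)) : Prop :=
  IsBlock n p B ∧ B ≠ Finset.univ

/-- A tanglegram has a proper subtanglegram iff it has a proper block of size
at least two. -/
def HasProperSub (n : ℕ) (p : LTree (Fin n) × LTree (Fin n)) : Prop :=
  ∃ B, ProperBlock n p B ∧ 2 ≤ B.card

/-- An irreducible tanglegram: one with no proper subtanglegram. -/
def IrredPair (n : ℕ) (p : LTree (Fin n) × LTree (Fin n)) : Prop :=
  ¬ HasProperSub n p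

/-- A maximal proper block (the leaf set of a maximal proper subtanglegram,
or a leaf of the irreducible component). -/
def MaxBlock (n : ℕ) (p : LTree (Fin n) × LTree (Fin n)) (B : Finset (Fin n)) : Prop :=
  ProperBlock n p B ∧ ∀ B', ProperBlock n p B' → B ⊆ B' → B = B'

/-- The size of the irreducible component `irr(𝒯)`: the number of maximal
proper blocks (these partition the leaf set); the tanglegram of size `1` has
irreducible component of size `1`. -/
noncomputable def irrSize (n : ℕ) (p : LTree (Fin n) × LTree (Fin n)) : ℕ :=
  if n ≤ 1 then n else Set.ncard {B | MaxBlock n p B}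

/-- The number of isomorphism classes of planar tanglegrams of size `n`
satisfying a property `P` (assumed isomorphism-invariant). -/
noncomputable def tangCount (n : ℕ) (P : LTree (Fin n) × LTree (Fin n) → Prop) : ℕ :=
  Nat.card
    (Quot fun a b : {p : LTree (Fin n) × LTree (Fin n) //
        ValidPair n p ∧ PlanarPair n p ∧ P p} => PairIso a.1 b.1)

/-- `t_n` : the number of planar tanglegrams of size `n`. -/
noncomputable def numPlanar (n : ℕ) : ℕ := tangCount n fun _ => True

/-- `t_{n,k}` : the number of planar tanglegrams of size `n` whose irreducible
component has size `k`. -/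
noncomputable def numPlanarIrr (n k : ℕ) : ℕ := tangCount n fun p => irrSize n p = k

/-- `h_k` : the number of irreducible planar tanglegrams of size `k`. -/
noncomputable def numIrred (k : ℕ) : ℕ := tangCount k fun p => IrredPair k p

/-- The coefficient of `x^k y^k` in `H(x,y)`: `1/2` for `k = 2`, the number
`h_k` of irreducible planar tanglegrams of size `k` for `k ≥ 3`, and `0`
otherwise. -/
noncomputable def hCoeff (k : ℕ) : ℚ :=
  if k = 2 then 1 / 2 else if 3 ≤ k then (numIrred k : ℚ) else 0

namespace LTree

variable {α β ι κ : Type}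

/-- Relabel the leaves of a tree. -/
def map (f : α → β) : LTree α → LTree β
  | .leaf a => .leaf (f a)
  | .node l r => .node (l.map f) (r.map f)

/-- Substitute a tree for every leaf of a tree. -/
def bind : LTree ι → (ι → LTree α) → LTree α
  | .leaf i, s => s i
  | .node l r, s => .node (l.bind s) (r.bind s)

theorem leafList_map (f : α → β) (t : LTree α) :
    (t.map f).leafList = t.leafList.map f := by
  induction t with
  | leaf a => rfl
  | node l r ihl ihr => simp [map, leafList, ihl, ihr]

theorem leafList_bind (p : LTree ι) (s : ι → LTree α) :
    (p.bind s).leafList = p.leafList.flatMap fun i => (s i).leafList := by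
  induction p with
  | leaf a => simp [bind, leafList]
  | node l r ihl ihr => simp [bind, leafList, ihl, ihr]

theorem mem_leafList_bind {p : LTree ι} {s : ι → LTree α} {a : α} :
    a ∈ (p.bind s).leafList ↔ ∃ i ∈ p.leafList, a ∈ (s i).leafList := by
  simp [leafList_bind]

theorem exists_mem_leafList (t : LTree α) : ∃ a, a ∈ t.leafList := by
  induction t with
  | leaf a => exact ⟨a, by simp [leafList]⟩
  | node l r ihl _ =>
    obtain ⟨a, ha⟩ := ihl
    exact ⟨a, by simp [leafList, ha]⟩

theorem leafList_length_pos (t : LTree α) : 0 < t.leafList.length :=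
  List.length_pos_iff_exists_mem.2 t.exists_mem_leafList

theorem mem_leafFinset [DecidableEq α] {t : LTree α} {a : α} :
    a ∈ t.leafFinset ↔ a ∈ t.leafList := by
  simp [leafFinset]

theorem nodup_node {l r : LTree α} :
    (LTree.node l r).leafList.Nodup ↔
      l.leafList.Nodup ∧ r.leafList.Nodup ∧ ∀ a ∈ l.leafList, a ∉ r.leafList := by
  simp only [leafList, List.nodup_append]
  refine and_congr_right fun _ => and_congr_right fun _ => ?_
  exact ⟨fun h a ha hb => h a ha a hb rfl, fun h a ha b hb hab => h a ha (hab ▸ hb)⟩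

theorem eq_leaf_of_length_le_one {t : LTree α} (h : t.leafList.length ≤ 1) :
    ∃ a, t = .leaf a := by
  cases t with
  | leaf a => exact ⟨a, rfl⟩
  | node l r =>
    have := l.leafList_length_pos
    have := r.leafList_length_pos
    simp only [leafList, List.length_append] at h
    omega

theorem finite_leafList_length_le [Finite α] (m : ℕ) :
    {t : LTree α | t.leafList.length ≤ m}.Finite := by
  induction m with
  | zero =>
    refine Set.Finite.subset Set.finite_empty fun t ht => ?_
    have := t.leafList_length_pos
    simp only [Set.mem_ofPred_eq] at ht
    omega
  | succ m ih =>
    refine ((Set.finite_range LTree.leaf).union (ih.image2 LTree.node ih)).subset fun t ht => ?_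
    cases t with
    | leaf a => exact Or.inl ⟨a, rfl⟩
    | node l r =>
      have := l.leafList_length_pos
      have := r.leafList_length_pos
      simp only [Set.mem_ofPred_eq, leafList, List.length_append] at ht
      exact Or.inr ⟨l, by simp only [Set.mem_ofPred_eq]; omega, r,
        by simp only [Set.mem_ofPred_eq]; omega, rfl⟩

end LTree

namespace TreeRel

variable {α β γ ι κ : Type}

theorem of_map (f : α → β) (t : LTree α) : TreeRel f t (t.map f) := by
  induction t with
  | leaf a => exact .leaf a
  | node l r ihl ihr => exact .node ihl ihr

theorem rfl_id (t : LTree α) : TreeRel id t t := by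
  induction t with
  | leaf a => exact .leaf (f := id) a
  | node l r ihl ihr => exact .node ihl ihr

theorem congr {f g : α → β} {t : LTree α} {t' : LTree β} (h : TreeRel f t t')
    (hfg : ∀ a ∈ t.leafList, f a = g a) : TreeRel g t t' := by
  induction h with
  | leaf a => rw [hfg a (by simp [LTree.leafList])]; exact .leaf a
  | node _ _ ih1 ih2 =>
    simp only [LTree.leafList, List.mem_append] at hfg
    exact .node (ih1 fun a ha => hfg a (.inl ha)) (ih2 fun a ha => hfg a (.inr ha))
  | swap _ _ ih1 ih2 =>
    simp only [LTree.leafList, List.mem_append] at hfg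
    exact .swap (ih1 fun a ha => hfg a (.inl ha)) (ih2 fun a ha => hfg a (.inr ha))

theorem trans {f : α → β} {g : β → γ} {t : LTree α} {t' : LTree β} {t'' : LTree γ}
    (h : TreeRel f t t') (h' : TreeRel g t' t'') : TreeRel (g ∘ f) t t'' := by
  induction h generalizing t'' with
  | leaf a => cases h'; exact .leaf (f := g ∘ f) a
  | node _ _ ih1 ih2 =>
    cases h' with
    | node h1 h2 => exact .node (ih1 h1) (ih2 h2)
    | swap h1 h2 => exact .swap (ih1 h1) (ih2 h2)
  | swap _ _ ih1 ih2 =>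
    cases h' with
    | node h1 h2 => exact .swap (ih1 h2) (ih2 h1)
    | swap h1 h2 => exact .node (ih1 h2) (ih2 h1)

theorem symm {f : α → β} {g : β → α} {t : LTree α} {t' : LTree β} (h : TreeRel f t t')
    (hg : ∀ a ∈ t.leafList, g (f a) = a) : TreeRel g t' t := by
  induction h with
  | leaf a =>
    have := TreeRel.leaf (f := g) (f a)
    rwa [hg a (by simp [LTree.leafList])] at this
  | node _ _ ih1 ih2 =>
    simp only [LTree.leafList, List.mem_append] at hg
    exact .node (ih1 fun a ha => hg a (.inl ha)) (ih2 fun a ha => hg a (.inr ha))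
  | swap _ _ ih1 ih2 =>
    simp only [LTree.leafList, List.mem_append] at hg
    exact .swap (ih2 fun a ha => hg a (.inr ha)) (ih1 fun a ha => hg a (.inl ha))

theorem symm_id {t t' : LTree α} (h : TreeRel id t t') : TreeRel id t' t :=
  h.symm fun _ _ => rfl

theorem perm {f : α → β} {t : LTree α} {t' : LTree β} (h : TreeRel f t t') :
    (t.leafList.map f).Perm t'.leafList := by
  induction h with
  | leaf a => exact .refl _
  | node _ _ ih1 ih2 =>
    simp only [LTree.leafList, List.map_append]
    exact ih1.append ih2
  | swap _ _ ih1 ih2 =>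
    simp only [LTree.leafList, List.map_append]
    exact (ih1.append ih2).trans List.perm_append_comm

theorem perm_id {t t' : LTree α} (h : TreeRel id t t') : t.leafList.Perm t'.leafList := by
  simpa using h.perm

theorem length_eq {f : α → β} {t : LTree α} {t' : LTree β} (h : TreeRel f t t') :
    t.leafList.length = t'.leafList.length := by
  simpa using h.perm.length_eq

theorem mem {f : α → β} {t : LTree α} {t' : LTree β} (h : TreeRel f t t') {a : α}
    (ha : a ∈ t.leafList) : f a ∈ t'.leafList :=
  h.perm.mem_iff.1 (List.mem_map_of_mem ha)

theorem exists_mem {f : α → β} {t : LTree α} {t' : LTree β} (h : TreeRel f t t') {b : β}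
    (hb : b ∈ t'.leafList) : ∃ a ∈ t.leafList, f a = b :=
  List.mem_map.1 (h.perm.mem_iff.2 hb)

theorem injOn {f : α → β} {t : LTree α} {t' : LTree β} (h : TreeRel f t t')
    (ht' : t'.leafList.Nodup) {a b : α} (ha : a ∈ t.leafList) (hb : b ∈ t.leafList)
    (hab : f a = f b) : a = b :=
  List.inj_on_of_nodup_map (h.perm.nodup_iff.2 ht') ha hb hab

theorem exists_isSub {f : α → β} {t u : LTree α} {t' : LTree β} (h : TreeRel f t t')
    (hu : IsSub u t) : ∃ u', IsSub u' t' ∧ TreeRel f u u' := by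
  induction h with
  | leaf a => cases hu; exact ⟨_, .refl _, .leaf a⟩
  | node h1 h2 ih1 ih2 =>
    cases hu with
    | refl => exact ⟨_, .refl _, .node h1 h2⟩
    | left _ hu => obtain ⟨u', h, h'⟩ := ih1 hu; exact ⟨u', .left _ h, h'⟩
    | right _ hu => obtain ⟨u', h, h'⟩ := ih2 hu; exact ⟨u', .right _ h, h'⟩
  | swap h1 h2 ih1 ih2 =>
    cases hu with
    | refl => exact ⟨_, .refl _, .swap h1 h2⟩
    | left _ hu => obtain ⟨u', h, h'⟩ := ih1 hu; exact ⟨u', .right _ h, h'⟩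
    | right _ hu => obtain ⟨u', h, h'⟩ := ih2 hu; exact ⟨u', .left _ h, h'⟩

theorem bind {f : ι → κ} {g : α → β} {p : LTree ι} {p' : LTree κ} {s : ι → LTree α}
    {s' : κ → LTree β} (h : TreeRel f p p')
    (hs : ∀ i ∈ p.leafList, TreeRel g (s i) (s' (f i))) :
    TreeRel g (p.bind s) (p'.bind s') := by
  induction h with
  | leaf a => exact hs a (by simp [LTree.leafList])
  | node _ _ ih1 ih2 =>
    simp only [LTree.leafList, List.mem_append] at hs
    exact .node (ih1 fun a ha => hs a (.inl ha)) (ih2 fun a ha => hs a (.inr ha))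
  | swap _ _ ih1 ih2 =>
    simp only [LTree.leafList, List.mem_append] at hs
    exact .swap (ih1 fun a ha => hs a (.inl ha)) (ih2 fun a ha => hs a (.inr ha))

theorem mem_of_bind {f : ι → κ} {g : α → β} {p : LTree ι} {p' : LTree κ} {s : ι → LTree α}
    {s' : κ → LTree β} (h : TreeRel g (p.bind s) (p'.bind s'))
    (hs : ∀ i ∈ p.leafList, ∀ a ∈ (s i).leafList, g a ∈ (s' (f i)).leafList)
    (hs' : ∀ i j b, b ∈ (s' i).leafList → b ∈ (s' j).leafList → i = j)
    {i : ι} (hi : i ∈ p.leafList) : f i ∈ p'.leafList := by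
  obtain ⟨a, ha⟩ := (s i).exists_mem_leafList
  obtain ⟨j, hj, hb⟩ := LTree.mem_leafList_bind.1
    (h.mem (LTree.mem_leafList_bind.2 ⟨i, hi, ha⟩))
  rwa [hs' _ _ _ (hs i hi a ha) hb]

theorem exists_mem_of_bind {f : ι → κ} {g : α → β} {p : LTree ι} {p' : LTree κ}
    {s : ι → LTree α} {s' : κ → LTree β} (h : TreeRel g (p.bind s) (p'.bind s'))
    (hs : ∀ i ∈ p.leafList, ∀ a ∈ (s i).leafList, g a ∈ (s' (f i)).leafList)
    (hs' : ∀ i j b, b ∈ (s' i).leafList → b ∈ (s' j).leafList → i = j)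
    {j : κ} (hj : j ∈ p'.leafList) : ∃ i ∈ p.leafList, f i = j := by
  obtain ⟨b, hb⟩ := (s' j).exists_mem_leafList
  obtain ⟨a, ha, rfl⟩ := h.exists_mem (LTree.mem_leafList_bind.2 ⟨j, hj, hb⟩)
  obtain ⟨i, hi, ha⟩ := LTree.mem_leafList_bind.1 ha
  exact ⟨i, hi, hs' _ _ _ (hs i hi a ha) hb⟩

/-- An isomorphism of substituted trees that respects the substituted parts induces an
isomorphism of the underlying trees. -/
theorem of_bind {f : ι → κ} {g : α → β} {p : LTree ι} {p' : LTree κ} {s : ι → LTree α}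
    {s' : κ → LTree β} (h : TreeRel g (p.bind s) (p'.bind s'))
    (hs : ∀ i ∈ p.leafList, ∀ a ∈ (s i).leafList, g a ∈ (s' (f i)).leafList)
    (hs' : ∀ i j b, b ∈ (s' i).leafList → b ∈ (s' j).leafList → i = j)
    (hf : Function.Injective f) (hp : p.leafList.Nodup) (hp' : p'.leafList.Nodup) :
    TreeRel f p p' := by
  induction p generalizing p' with
  | leaf i =>
    have hleaf : ∀ j ∈ p'.leafList, f i = j := fun j hj => by
      simpa [LTree.leafList] using h.exists_mem_of_bind hs hs' hj
    cases p' with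
    | leaf j =>
      rw [← hleaf j (by simp [LTree.leafList])]
      exact .leaf i
    | node l r =>
      obtain ⟨x, hx⟩ := l.exists_mem_leafList
      obtain ⟨y, hy⟩ := r.exists_mem_leafList
      have h1 := hleaf x (by simp [LTree.leafList, hx])
      have h2 := hleaf y (by simp [LTree.leafList, hy])
      exact absurd (h1.symm.trans h2 ▸ hy) ((LTree.nodup_node.1 hp').2.2 x hx)
  | node l r ihl ihr =>
    obtain ⟨hl, hr, hlr⟩ := LTree.nodup_node.1 hp
    cases p' with
    | leaf j =>
      have hleaf : ∀ i ∈ (LTree.node l r).leafList, f i = j := fun i hi => by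
        simpa [LTree.leafList] using h.mem_of_bind hs hs' hi
      obtain ⟨x, hx⟩ := l.exists_mem_leafList
      obtain ⟨y, hy⟩ := r.exists_mem_leafList
      have h1 := hleaf x (by simp [LTree.leafList, hx])
      have h2 := hleaf y (by simp [LTree.leafList, hy])
      exact absurd (hf (h2.trans h1.symm) ▸ hy) (hlr x hx)
    | node l' r' =>
      obtain ⟨hl', hr', -⟩ := LTree.nodup_node.1 hp'
      simp only [LTree.leafList, List.mem_append] at hs
      cases h with
      | node h1 h2 =>
        exact .node (ihl h1 (fun i hi => hs i (.inl hi)) hl hl')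
          (ihr h2 (fun i hi => hs i (.inr hi)) hr hr')
      | swap h1 h2 =>
        exact .swap (ihl h1 (fun i hi => hs i (.inl hi)) hl hr')
          (ihr h2 (fun i hi => hs i (.inr hi)) hr hl')

/-- A leaf moved by an automorphism lies below a node whose children are exchanged. -/
theorem exists_swapped {f : α → α} {t : LTree α} (h : TreeRel f t t) {x : α}
    (hx : x ∈ t.leafList) (hfx : f x ≠ x) :
    ∃ l r, IsSub (.node l r) t ∧ x ∈ (LTree.node l r).leafList ∧
      TreeRel f l r ∧ TreeRel f r l := by
  induction t with
  | leaf a =>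
    simp only [LTree.leafList, List.mem_singleton] at hx
    subst hx
    exact absurd (by simpa [LTree.leafList] using h.mem (List.mem_singleton_self x)) hfx
  | node l r ihl ihr =>
    have key : ∀ {u}, TreeRel f (.node l r) u → u = .node l r →
        (TreeRel f l l ∧ TreeRel f r r) ∨ (TreeRel f l r ∧ TreeRel f r l) := by
      intro u hu huu
      cases hu with
      | node h1 h2 => cases huu; exact .inl ⟨h1, h2⟩
      | swap h1 h2 => cases huu; exact .inr ⟨h1, h2⟩
    rcases key h rfl with ⟨h1, h2⟩ | ⟨h1, h2⟩
    · simp only [LTree.leafList, List.mem_append] at hx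
      rcases hx with hx | hx
      · obtain ⟨l', r', hs, h⟩ := ihl h1 hx
        exact ⟨l', r', .left _ hs, h⟩
      · obtain ⟨l', r', hs, h⟩ := ihr h2 hx
        exact ⟨l', r', .right _ hs, h⟩
    · exact ⟨l, r, .refl _, hx, h1, h2⟩

end TreeRel

namespace IsSub

variable {α ι : Type}

theorem sublist {u t : LTree α} (h : IsSub u t) : u.leafList.Sublist t.leafList := by
  induction h with
  | refl => exact .refl _
  | left r _ ih => exact ih.trans (List.sublist_append_left _ _)
  | right l _ ih => exact ih.trans (List.sublist_append_right _ _)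

theorem isInfix {u t : LTree α} (h : IsSub u t) : u.leafList <:+: t.leafList := by
  induction h with
  | refl => exact List.infix_rfl
  | left r _ ih => exact ih.trans (List.prefix_append _ _).isInfix
  | right l _ ih => exact ih.trans (List.suffix_append _ _).isInfix

theorem mem {u t : LTree α} (h : IsSub u t) {a : α} (ha : a ∈ u.leafList) : a ∈ t.leafList :=
  h.sublist.subset ha

theorem nodup {u t : LTree α} (h : IsSub u t) (ht : t.leafList.Nodup) : u.leafList.Nodup :=
  ht.sublist h.sublist

theorem trans {u v t : LTree α} (h : IsSub u v) (h' : IsSub v t) : IsSub u t := by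
  induction h' with
  | refl => exact h
  | left r _ ih => exact .left r (ih h)
  | right l _ ih => exact .right l (ih h)

theorem eq_of_length_le {u t : LTree α} (h : IsSub u t)
    (hl : t.leafList.length ≤ u.leafList.length) : u = t := by
  cases h with
  | refl => rfl
  | @left _ l r h =>
    have := h.sublist.length_le
    have := r.leafList_length_pos
    simp only [LTree.leafList, List.length_append] at hl
    omega
  | @right l _ r h =>
    have := h.sublist.length_le
    have := l.leafList_length_pos
    simp only [LTree.leafList, List.length_append] at hl
    omega

theorem total_of_mem {u v t : LTree α} (ht : t.leafList.Nodup) (hu : IsSub u t) (hv : IsSub v t)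
    {a : α} (hau : a ∈ u.leafList) (hav : a ∈ v.leafList) : IsSub u v ∨ IsSub v u := by
  induction t with
  | leaf b => cases hu; cases hv; exact .inl (.refl _)
  | node l r ihl ihr =>
    obtain ⟨hl, hr, hlr⟩ := LTree.nodup_node.1 ht
    cases hu with
    | refl => exact .inr hv
    | left _ hu' =>
      cases hv with
      | refl => exact .inl (.left _ hu')
      | left _ hv => exact ihl hl hu' hv
      | right _ hv => exact absurd (hv.mem hav) (hlr a (hu'.mem hau))
    | right _ hu' =>
      cases hv with
      | refl => exact .inl (.right _ hu')
      | left _ hv => exact absurd (hu'.mem hau) (hlr a (hv.mem hav))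
      | right _ hv => exact ihr hr hu' hv

theorem eq_of_mem_iff {u v t : LTree α} (ht : t.leafList.Nodup) (hu : IsSub u t)
    (hv : IsSub v t) (h : ∀ a, a ∈ u.leafList ↔ a ∈ v.leafList) : u = v := by
  have hp := ((List.perm_ext_iff_of_nodup (hu.nodup ht) (hv.nodup ht)).2 h).length_eq
  obtain ⟨a, ha⟩ := u.exists_mem_leafList
  rcases hu.total_of_mem ht hv ha ((h a).1 ha) with h | h
  · exact h.eq_of_length_le hp.ge
  · exact (h.eq_of_length_le hp.le).symm

theorem exists_leaf {t : LTree α} {a : α} (h : a ∈ t.leafList) : IsSub (.leaf a) t := by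
  induction t with
  | leaf b =>
    simp only [LTree.leafList, List.mem_singleton] at h
    exact h ▸ .refl _
  | node l r ihl ihr =>
    simp only [LTree.leafList, List.mem_append] at h
    exact h.elim (fun h => .left _ (ihl h)) fun h => .right _ (ihr h)

theorem bind {u t : LTree ι} (h : IsSub u t) (s : ι → LTree α) :
    IsSub (u.bind s) (t.bind s) := by
  induction h with
  | refl => exact .refl _
  | left r _ ih => exact .left _ ih
  | right l _ ih => exact .right _ ih

theorem bind_of_mem {t : LTree ι} {i : ι} (h : i ∈ t.leafList) (s : ι → LTree α) :
    IsSub (s i) (t.bind s) :=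
  (exists_leaf h).bind s

theorem bind_cases {t : LTree ι} {s : ι → LTree α} {u : LTree α} (h : IsSub u (t.bind s)) :
    (∃ v, IsSub v t ∧ u = v.bind s) ∨ ∃ i ∈ t.leafList, IsSub u (s i) := by
  induction t with
  | leaf i => exact .inr ⟨i, by simp [LTree.leafList], h⟩
  | node l r ihl ihr =>
    cases h with
    | refl => exact .inl ⟨_, .refl _, rfl⟩
    | left _ h =>
      rcases ihl h with ⟨v, hv, rfl⟩ | ⟨i, hi, h⟩
      · exact .inl ⟨v, .left _ hv, rfl⟩
      · exact .inr ⟨i, by simp [LTree.leafList, hi], h⟩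
    | right _ h =>
      rcases ihr h with ⟨v, hv, rfl⟩ | ⟨i, hi, h⟩
      · exact .inl ⟨v, .right _ hv, rfl⟩
      · exact .inr ⟨i, by simp [LTree.leafList, hi], h⟩

end IsSub

/-- A tree covered by disjoint subtrees `s i` is obtained by substituting them into a tree. -/
theorem LTree.exists_bind_eq {α ι : Type} {s : ι → LTree α} {t : LTree α}
    (ht : t.leafList.Nodup)
    (hs : ∀ a ∈ t.leafList, ∃ i, a ∈ (s i).leafList ∧ IsSub (s i) t) :
    ∃ p : LTree ι, p.bind s = t := by
  induction t with
  | leaf a =>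
    obtain ⟨i, -, hi⟩ := hs a (by simp [leafList])
    refine ⟨.leaf i, hi.eq_of_length_le ?_⟩
    exact (s i).leafList_length_pos
  | node l r ihl ihr =>
    obtain ⟨hl, hr, hlr⟩ := nodup_node.1 ht
    by_cases h : ∃ i, s i = .node l r
    · obtain ⟨i, hi⟩ := h
      exact ⟨.leaf i, hi⟩
    push Not at h
    have key : ∀ i, IsSub (s i) (.node l r) → IsSub (s i) l ∨ IsSub (s i) r := by
      intro i hi
      have := h i
      generalize s i = u at *
      cases hi with
      | refl => exact absurd rfl this
      | left _ h => exact .inl h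
      | right _ h => exact .inr h
    obtain ⟨p, hp⟩ := ihl hl fun a ha => by
      obtain ⟨i, hai, hi⟩ := hs a (by simp [leafList, ha])
      exact ⟨i, hai, (key i hi).resolve_right fun h => hlr a ha (h.mem hai)⟩
    obtain ⟨q, hq⟩ := ihr hr fun a ha => by
      obtain ⟨i, hai, hi⟩ := hs a (by simp [leafList, ha])
      exact ⟨i, hai, (key i hi).resolve_left fun h => hlr a (h.mem hai) ha⟩
    exact ⟨.node p q, by rw [bind, hp, hq]⟩

/-- Concatenations of blocks determine the order of the blocks and the blocks themselves. -/
theorem List.flatMap_eq_flatMap {α ι : Type} {A B : ι → List α} {L M : List ι}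
    (h : L.flatMap A = M.flatMap B) (hAB : ∀ i, (A i).Perm (B i)) (hA : ∀ i, A i ≠ [])
    (hdisj : ∀ i j a, a ∈ A i → a ∈ A j → i = j) : L = M ∧ ∀ i ∈ L, A i = B i := by
  induction L generalizing M with
  | nil =>
    cases M with
    | nil => simp
    | cons j M =>
      have := (hAB j).symm
      simp only [List.flatMap_nil, List.flatMap_cons] at h
      rw [(List.append_eq_nil_iff.1 h.symm).1] at this
      exact absurd this.nil_eq.symm (hA j)
  | cons i L ih =>
    cases M with
    | nil =>
      simp only [List.flatMap_nil, List.flatMap_cons] at h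
      exact absurd (List.append_eq_nil_iff.1 h).1 (hA i)
    | cons j M =>
      simp only [List.flatMap_cons] at h
      have hij : i = j := by
        obtain ⟨a, l, ha⟩ := List.exists_cons_of_ne_nil (hA i)
        have hB : B j ≠ [] := fun hB => hA j (List.perm_nil.1 (hB ▸ hAB j))
        obtain ⟨b, m, hb⟩ := List.exists_cons_of_ne_nil hB
        rw [ha, hb, List.cons_append, List.cons_append, List.cons.injEq] at h
        refine hdisj i j a (by simp [ha]) ((hAB j).mem_iff.2 ?_)
        simp [hb, h.1]
      subst hij
      obtain ⟨h1, h2⟩ := List.append_inj h (hAB i).length_eq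
      obtain ⟨rfl, h3⟩ := ih h2
      exact ⟨rfl, by simpa [h1] using h3⟩

theorem LTree.nodup_bind {α ι : Type} {p : LTree ι} {s : ι → LTree α}
    (hp : p.leafList.Nodup) (hs : ∀ i, (s i).leafList.Nodup)
    (hdisj : ∀ i j a, a ∈ (s i).leafList → a ∈ (s j).leafList → i = j) :
    (p.bind s).leafList.Nodup := by
  rw [leafList_bind, List.nodup_flatMap]
  refine ⟨fun i _ => hs i, hp.imp fun {i j} hij a hi hj => hij (hdisj i j a hi hj)⟩

theorem LTree.nodup_of_bind {α ι : Type} {p : LTree ι} {s : ι → LTree α}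
    (h : (p.bind s).leafList.Nodup) : p.leafList.Nodup := by
  induction p with
  | leaf i => simp [leafList]
  | node l r ihl ihr =>
    obtain ⟨hl, hr, hlr⟩ := nodup_node.1 h
    refine nodup_node.2 ⟨ihl hl, ihr hr, fun i hi hi' => ?_⟩
    obtain ⟨a, ha⟩ := (s i).exists_mem_leafList
    exact hlr a (mem_leafList_bind.2 ⟨i, hi, ha⟩) (mem_leafList_bind.2 ⟨i, hi', ha⟩)

section Tanglegram

variable {α β γ ι κ : Type}

/-- A pair of trees with distinct leaves and the same leaf labels, on any label type. -/
def IsTanglegram (p : LTree α × LTree α) : Prop :=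
  p.1.leafList.Nodup ∧ p.1.leafList.Perm p.2.leafList

/-- Isomorphism of pairs of trees along a relabeling that need not be injective outside the
leaves. -/
def TanglegramIso (p : LTree α × LTree α) (q : LTree β × LTree β) : Prop :=
  ∃ f : α → β, TreeRel f p.1 q.1 ∧ TreeRel f p.2 q.2

/-- A pair of trees whose children can be reordered so that the leaf sequences agree. -/
def HasPlanarLayout (p : LTree α × LTree α) : Prop :=
  ∃ q : LTree α × LTree α, TreeRel id p.1 q.1 ∧ TreeRel id p.2 q.2 ∧
    q.1.leafList = q.2.leafList

/-- Substitute a pair of trees for every matched pair of leaves. -/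
def compose (I : LTree ι × LTree ι) (s : ι → LTree α × LTree α) : LTree α × LTree α :=
  (I.1.bind fun i => (s i).1, I.2.bind fun i => (s i).2)

/-- Tanglegrams whose leaf sets partition the label type. -/
structure LeafPartition (s : ι → LTree α × LTree α) : Prop where
  isTanglegram (i : ι) : IsTanglegram (s i)
  disjoint (i j : ι) (a : α) : a ∈ (s i).1.leafList → a ∈ (s j).1.leafList → i = j
  covers (a : α) : ∃ i, a ∈ (s i).1.leafList

theorem IsTanglegram.mem_iff {p : LTree α × LTree α} (hp : IsTanglegram p) {a : α} :
    a ∈ p.1.leafList ↔ a ∈ p.2.leafList :=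
  hp.2.mem_iff

theorem IsTanglegram.nodup_snd {p : LTree α × LTree α} (hp : IsTanglegram p) :
    p.2.leafList.Nodup :=
  hp.2.nodup_iff.1 hp.1

theorem validPair_iff {n : ℕ} {p : LTree (Fin n) × LTree (Fin n)} :
    ValidPair n p ↔ IsTanglegram p ∧ ∀ a, a ∈ p.1.leafList := by
  constructor
  · rintro ⟨h1, h2⟩
    exact ⟨⟨h1.nodup_iff.2 (List.nodup_finRange n), h1.trans h2.symm⟩,
      fun a => h1.mem_iff.2 (List.mem_finRange a)⟩
  · rintro ⟨h, hm⟩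
    have h1 : p.1.leafList.Perm (List.finRange n) :=
      (List.perm_ext_iff_of_nodup h.1 (List.nodup_finRange n)).2 fun a => by simp [hm]
    exact ⟨h1, h.2.symm.trans h1⟩

theorem ValidPair.isTanglegram {n : ℕ} {p : LTree (Fin n) × LTree (Fin n)}
    (hp : ValidPair n p) : IsTanglegram p :=
  (validPair_iff.1 hp).1

theorem ValidPair.mem {n : ℕ} {p : LTree (Fin n) × LTree (Fin n)}
    (hp : ValidPair n p) (a : Fin n) : a ∈ p.1.leafList :=
  (validPair_iff.1 hp).2 a

theorem ValidPair.mem_snd {n : ℕ} {p : LTree (Fin n) × LTree (Fin n)}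
    (hp : ValidPair n p) (a : Fin n) : a ∈ p.2.leafList :=
  hp.isTanglegram.mem_iff.1 (hp.mem a)

theorem ValidPair.length {n : ℕ} {p : LTree (Fin n) × LTree (Fin n)}
    (hp : ValidPair n p) : p.1.leafList.length = n := by
  simpa using hp.1.length_eq

theorem TanglegramIso.refl (p : LTree α × LTree α) : TanglegramIso p p :=
  ⟨id, .rfl_id _, .rfl_id _⟩

theorem TanglegramIso.trans {p : LTree α × LTree α} {q : LTree β × LTree β}
    {r : LTree γ × LTree γ} (h : TanglegramIso p q) (h' : TanglegramIso q r) :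
    TanglegramIso p r := by
  obtain ⟨f, h1, h2⟩ := h
  obtain ⟨g, h3, h4⟩ := h'
  exact ⟨g ∘ f, h1.trans h3, h2.trans h4⟩

theorem TreeRel.exists_inverse {f : α → β} {t : LTree α} {t' : LTree β} (h : TreeRel f t t')
    (ht' : t'.leafList.Nodup) :
    ∃ g : β → α, (∀ a ∈ t.leafList, g (f a) = a) ∧ ∀ b ∈ t'.leafList, f (g b) = b := by
  obtain ⟨a₀, -⟩ := t.exists_mem_leafList
  have : Nonempty α := ⟨a₀⟩
  have hinj : Set.InjOn f {a | a ∈ t.leafList} := fun a ha b hb hab => h.injOn ht' ha hb hab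
  refine ⟨Function.invFunOn f {a | a ∈ t.leafList}, fun a ha => hinj.leftInvOn_invFunOn ha,
    fun b hb => ?_⟩
  obtain ⟨a, ha, rfl⟩ := h.exists_mem hb
  exact Function.invFunOn_eq ⟨a, ha, rfl⟩

theorem TanglegramIso.symm {p : LTree α × LTree α} {q : LTree β × LTree β}
    (h : TanglegramIso p q) (hp : IsTanglegram p) (hq : IsTanglegram q) :
    TanglegramIso q p := by
  obtain ⟨f, h1, h2⟩ := h
  obtain ⟨g, hg, -⟩ := h1.exists_inverse hq.1
  exact ⟨g, h1.symm hg, h2.symm fun a ha => hg a (hp.mem_iff.2 ha)⟩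

theorem TreeRel.injective_of_valid {n : ℕ} {f : Fin n → β} {t : LTree (Fin n)} {t' : LTree β}
    (h : TreeRel f t t') (ht : ∀ a, a ∈ t.leafList) (ht' : t'.leafList.Nodup) :
    Function.Injective f :=
  fun a b hab => h.injOn ht' (ht a) (ht b) hab

theorem pairIso_iff {n m : ℕ} {p : LTree (Fin n) × LTree (Fin n)}
    {q : LTree (Fin m) × LTree (Fin m)} (hp : ValidPair n p) (hq : ValidPair m q) :
    PairIso p q ↔ TanglegramIso p q := by
  constructor
  · rintro ⟨f, -, h⟩
    exact ⟨f, h⟩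
  · rintro ⟨f, h1, h2⟩
    exact ⟨f, h1.injective_of_valid hp.mem hq.isTanglegram.1, h1, h2⟩

theorem IsTanglegram.of_pairIso {p : LTree α × LTree α} {q : LTree β × LTree β}
    (hp : IsTanglegram p) (h : PairIso p q) : IsTanglegram q := by
  obtain ⟨f, hf, h1, h2⟩ := h
  exact ⟨h1.perm.nodup_iff.1 (hp.1.map hf), h1.perm.symm.trans ((hp.2.map f).trans h2.perm)⟩

theorem HasPlanarLayout.of_iso {p : LTree α × LTree α} {q : LTree β × LTree β}
    (h : HasPlanarLayout p) (hq : IsTanglegram q) (hpq : TanglegramIso p q)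
    (hp : IsTanglegram p) : HasPlanarLayout q := by
  obtain ⟨r, hr1, hr2, hr⟩ := h
  obtain ⟨f, h1, h2⟩ := hpq
  obtain ⟨g, hg, hg'⟩ := h1.exists_inverse hq.1
  refine ⟨(r.1.map f, r.2.map f), ?_, ?_, by simp [LTree.leafList_map, hr]⟩
  · exact (((h1.symm hg).trans hr1).trans (.of_map f r.1)).congr hg'
  · exact (((h2.symm fun a ha => hg a (hp.mem_iff.2 ha)).trans hr2).trans (.of_map f r.2)).congr
      fun b hb => hg' b (hq.mem_iff.2 hb)

theorem planarPair_iff {n : ℕ} {p : LTree (Fin n) × LTree (Fin n)} (hp : ValidPair n p) :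
    PlanarPair n p ↔ HasPlanarLayout p := by
  constructor
  · rintro ⟨q, hpq, hq⟩
    have hqt := hp.isTanglegram.of_pairIso hpq
    obtain ⟨f, -, h⟩ := hpq
    exact HasPlanarLayout.of_iso ⟨q, .rfl_id _, .rfl_id _, hq⟩ hp.isTanglegram
      (TanglegramIso.symm ⟨f, h⟩ hp.isTanglegram hqt) hqt
  · rintro ⟨q, h1, h2, hq⟩
    exact ⟨q, ⟨id, Function.injective_id, h1, h2⟩, hq⟩

namespace LeafPartition

variable {s : ι → LTree α × LTree α}

theorem mem_iff (hs : LeafPartition s) {i : ι} {a : α} :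
    a ∈ (s i).2.leafList ↔ a ∈ (s i).1.leafList :=
  (hs.isTanglegram i).mem_iff.symm

theorem disjoint_snd (hs : LeafPartition s) (i j : ι) (a : α) (hi : a ∈ (s i).2.leafList)
    (hj : a ∈ (s j).2.leafList) : i = j :=
  hs.disjoint i j a (hs.mem_iff.1 hi) (hs.mem_iff.1 hj)

theorem validPair_compose {n k : ℕ} {s : Fin k → LTree (Fin n) × LTree (Fin n)}
    (hs : LeafPartition s) {I : LTree (Fin k) × LTree (Fin k)} (hI : ValidPair k I) :
    ValidPair n (compose I s) := by
  have h1 : ∀ a, a ∈ (compose I s).1.leafList := fun a => by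
    obtain ⟨i, hi⟩ := hs.covers a
    exact LTree.mem_leafList_bind.2 ⟨i, hI.mem i, hi⟩
  have h2 : ∀ a, a ∈ (compose I s).2.leafList := fun a => by
    obtain ⟨i, hi⟩ := hs.covers a
    exact LTree.mem_leafList_bind.2 ⟨i, hI.mem_snd i, hs.mem_iff.2 hi⟩
  have hn : (compose I s).1.leafList.Nodup :=
    LTree.nodup_bind hI.isTanglegram.1 (fun i => (hs.isTanglegram i).1) hs.disjoint
  have hn' : (compose I s).2.leafList.Nodup :=
    LTree.nodup_bind hI.isTanglegram.nodup_snd (fun i => (hs.isTanglegram i).nodup_snd)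
      hs.disjoint_snd
  exact validPair_iff.2 ⟨⟨hn, (List.perm_ext_iff_of_nodup hn hn').2 fun a => by simp [h1, h2]⟩, h1⟩

theorem exists_compose_eq {n k : ℕ} {s : Fin k → LTree (Fin n) × LTree (Fin n)}
    (hs : LeafPartition s) {t : LTree (Fin n) × LTree (Fin n)} (ht : ValidPair n t)
    (h1 : ∀ i, IsSub (s i).1 t.1) (h2 : ∀ i, IsSub (s i).2 t.2) :
    ∃ I, ValidPair k I ∧ compose I s = t := by
  obtain ⟨p, hp⟩ := LTree.exists_bind_eq (s := fun i => (s i).1) ht.isTanglegram.1 fun a _ => by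
    obtain ⟨i, hi⟩ := hs.covers a
    exact ⟨i, hi, h1 i⟩
  obtain ⟨q, hq⟩ := LTree.exists_bind_eq (s := fun i => (s i).2) ht.isTanglegram.nodup_snd
    fun a _ => by
      obtain ⟨i, hi⟩ := hs.covers a
      exact ⟨i, hs.mem_iff.2 hi, h2 i⟩
  have hpm : ∀ i, i ∈ p.leafList := fun i => by
    obtain ⟨a, ha⟩ := (s i).1.exists_mem_leafList
    have := ht.mem a
    rw [← hp, LTree.mem_leafList_bind] at this
    obtain ⟨j, hj, haj⟩ := this
    rwa [hs.disjoint i j a ha haj]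
  have hqm : ∀ i, i ∈ q.leafList := fun i => by
    obtain ⟨a, ha⟩ := (s i).2.exists_mem_leafList
    have := ht.mem_snd a
    rw [← hq, LTree.mem_leafList_bind] at this
    obtain ⟨j, hj, haj⟩ := this
    rwa [hs.disjoint_snd i j a ha haj]
  have hpn : p.leafList.Nodup := LTree.nodup_of_bind (hp.symm ▸ ht.isTanglegram.1)
  have hqn : q.leafList.Nodup := LTree.nodup_of_bind (hq.symm ▸ ht.isTanglegram.nodup_snd)
  exact ⟨(p, q), validPair_iff.2
    ⟨⟨hpn, (List.perm_ext_iff_of_nodup hpn hqn).2 fun a => by simp [hpm, hqm]⟩, hpm⟩,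
    Prod.ext hp hq⟩

theorem hasPlanarLayout_compose {I : LTree ι × LTree ι} (hI : HasPlanarLayout I)
    (hs : ∀ i, HasPlanarLayout (s i)) : HasPlanarLayout (compose I s) := by
  obtain ⟨J, h1, h2, hJ⟩ := hI
  choose r hr1 hr2 hr using hs
  refine ⟨compose J r, h1.bind fun i _ => hr1 i, h2.bind fun i _ => hr2 i, ?_⟩
  simp [compose, LTree.leafList_bind, hJ, hr]

/-- A layout of a substituted tree is obtained by substituting layouts. -/
theorem _root_.TreeRel.exists_bind {p : LTree ι} {s : ι → LTree α} {t : LTree α}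
    (h : TreeRel id (p.bind s) t) (hp : p.leafList.Nodup) (hpm : ∀ i, i ∈ p.leafList)
    (hs : ∀ i, (s i).leafList.Nodup)
    (hdisj : ∀ i j a, a ∈ (s i).leafList → a ∈ (s j).leafList → i = j) :
    ∃ (q : LTree ι) (r : ι → LTree α), TreeRel id p q ∧ (∀ i, TreeRel id (s i) (r i)) ∧
      q.bind r = t := by
  choose r hrt hr using fun i => h.exists_isSub (IsSub.bind_of_mem (hpm i) s)
  have ht : t.leafList.Nodup := h.perm_id.nodup_iff.1 (LTree.nodup_bind hp hs hdisj)
  obtain ⟨q, rfl⟩ := LTree.exists_bind_eq (s := r) ht fun a ha => by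
    obtain ⟨i, -, hi⟩ := LTree.mem_leafList_bind.1 (h.perm_id.mem_iff.2 ha)
    exact ⟨i, (hr i).perm_id.mem_iff.1 hi, hrt i⟩
  refine ⟨q, r, h.of_bind (fun i _ a ha => (hr i).mem ha) (fun i j a hi hj => ?_)
    Function.injective_id hp (LTree.nodup_of_bind ht), hr, rfl⟩
  exact hdisj i j a ((hr i).perm_id.mem_iff.2 hi) ((hr j).perm_id.mem_iff.2 hj)

theorem hasPlanarLayout_of_compose {n k : ℕ} {s : Fin k → LTree (Fin n) × LTree (Fin n)}
    (hs : LeafPartition s) {I : LTree (Fin k) × LTree (Fin k)} (hI : ValidPair k I)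
    (h : HasPlanarLayout (compose I s)) :
    HasPlanarLayout I ∧ ∀ i, HasPlanarLayout (s i) := by
  obtain ⟨t, h1, h2, ht⟩ := h
  obtain ⟨q1, r1, hq1, hr1, e1⟩ := h1.exists_bind hI.isTanglegram.1 hI.mem
    (fun i => (hs.isTanglegram i).1) hs.disjoint
  obtain ⟨q2, r2, hq2, hr2, e2⟩ := h2.exists_bind hI.isTanglegram.nodup_snd hI.mem_snd
    (fun i => (hs.isTanglegram i).nodup_snd) hs.disjoint_snd
  rw [← e1, ← e2, LTree.leafList_bind, LTree.leafList_bind] at ht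
  obtain ⟨hL, hr⟩ := List.flatMap_eq_flatMap ht
    (fun i => (hr1 i).perm_id.symm.trans ((hs.isTanglegram i).2.trans (hr2 i).perm_id))
    (fun i => List.ne_nil_of_length_pos (r1 i).leafList_length_pos)
    (fun i j a hi hj => hs.disjoint i j a ((hr1 i).perm_id.mem_iff.2 hi)
      ((hr1 j).perm_id.mem_iff.2 hj))
  exact ⟨⟨(q1, q2), hq1, hq2, hL⟩, fun i => ⟨(r1 i, r2 i), hr1 i, hr2 i,
    hr i (hq1.mem (hI.mem i))⟩⟩

/-- Isomorphic outer tanglegrams with isomorphic parts give isomorphic compositions. -/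
theorem iso_compose {f : ι → κ} {s' : κ → LTree β × LTree β} (hs : LeafPartition s)
    {I : LTree ι × LTree ι} {J : LTree κ × LTree κ} (h1 : TreeRel f I.1 J.1)
    (h2 : TreeRel f I.2 J.2) (h : ∀ i, TanglegramIso (s i) (s' (f i))) :
    TanglegramIso (compose I s) (compose J s') := by
  choose g hg1 hg2 using h
  choose c hc using hs.covers
  refine ⟨fun a => g (c a) a, h1.bind fun i _ => (hg1 i).congr fun a ha => ?_,
    h2.bind fun i _ => (hg2 i).congr fun a ha => ?_⟩
  · rw [hs.disjoint _ _ a ha (hc a)]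
  · rw [hs.disjoint _ _ a (hs.mem_iff.1 ha) (hc a)]

section Blocks

variable {n k : ℕ} {s : Fin k → LTree (Fin n) × LTree (Fin n)}
  {I : LTree (Fin k) × LTree (Fin k)}

theorem exists_subset_of_properBlock (hs : LeafPartition s) (hI : ValidPair k I)
    (hirr : IrredPair k I) {B : Finset (Fin n)} (hB : ProperBlock n (compose I s) B) :
    ∃ i, ∀ a ∈ B, a ∈ (s i).1.leafList := by
  obtain ⟨⟨⟨u, hu, huB⟩, v, hv, hvB⟩, hBne⟩ := hB
  rcases hu.bind_cases with ⟨u', hu', rfl⟩ | ⟨i, -, h⟩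
  swap
  · exact ⟨i, fun a ha => h.mem (LTree.mem_leafFinset.1 (huB ▸ ha))⟩
  rcases hv.bind_cases with ⟨v', hv', rfl⟩ | ⟨i, -, h⟩
  swap
  · exact ⟨i, fun a ha => hs.mem_iff.1 (h.mem (LTree.mem_leafFinset.1 (hvB ▸ ha)))⟩
  have huB' : ∀ a, a ∈ B ↔ ∃ i ∈ u'.leafList, a ∈ (s i).1.leafList := fun a => by
    rw [← huB, LTree.mem_leafFinset, LTree.mem_leafList_bind]
  have hvB' : ∀ a, a ∈ B ↔ ∃ i ∈ v'.leafList, a ∈ (s i).1.leafList := fun a => by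
    rw [← hvB, LTree.mem_leafFinset, LTree.mem_leafList_bind]
    simp only [hs.mem_iff]
  have huv : v'.leafFinset = u'.leafFinset := by
    ext i
    rw [LTree.mem_leafFinset, LTree.mem_leafFinset]
    obtain ⟨a, ha⟩ := (s i).1.exists_mem_leafList
    constructor
    · intro hi
      obtain ⟨j, hj, haj⟩ := (huB' a).1 ((hvB' a).2 ⟨i, hi, ha⟩)
      rwa [hs.disjoint i j a ha haj]
    · intro hi
      obtain ⟨j, hj, haj⟩ := (hvB' a).1 ((huB' a).2 ⟨i, hi, ha⟩)
      rwa [hs.disjoint i j a ha haj]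
  have hne : u'.leafFinset ≠ Finset.univ := fun h => hBne <| by
    ext a
    obtain ⟨i, hi⟩ := hs.covers a
    simpa using (huB' a).2 ⟨i, LTree.mem_leafFinset.1 (h ▸ Finset.mem_univ i), hi⟩
  have hcard : ¬ 2 ≤ u'.leafFinset.card := fun h =>
    hirr ⟨_, ⟨⟨⟨u', hu', rfl⟩, v', hv', huv⟩, hne⟩, h⟩
  rw [LTree.leafFinset, List.toFinset_card_of_nodup (hu'.nodup hI.isTanglegram.1)] at hcard
  obtain ⟨i, rfl⟩ := LTree.eq_leaf_of_length_le_one (t := u') (by omega)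
  exact ⟨i, fun a ha => by simpa [LTree.leafList] using (huB' a).1 ha⟩

theorem properBlock_part (hs : LeafPartition s) (hI : ValidPair k I) (hk : 2 ≤ k) (i : Fin k) :
    ProperBlock n (compose I s) (s i).1.leafFinset := by
  refine ⟨⟨⟨(s i).1, IsSub.bind_of_mem (hI.mem i) fun i => (s i).1, rfl⟩, (s i).2,
    IsSub.bind_of_mem (hI.mem_snd i) fun i => (s i).2, ?_⟩, fun h => ?_⟩
  · ext a
    rw [LTree.mem_leafFinset, LTree.mem_leafFinset, hs.mem_iff]
  · have : Nontrivial (Fin k) := Fin.nontrivial_iff_two_le.2 hk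
    obtain ⟨j, hj⟩ := exists_ne i
    obtain ⟨a, ha⟩ := (s j).1.exists_mem_leafList
    exact hj (hs.disjoint j i a ha (LTree.mem_leafFinset.1 (h ▸ Finset.mem_univ a)))

theorem maxBlock_compose_iff (hs : LeafPartition s) (hI : ValidPair k I) (hirr : IrredPair k I)
    (hk : 2 ≤ k) {B : Finset (Fin n)} :
    MaxBlock n (compose I s) B ↔ ∃ i, (s i).1.leafFinset = B := by
  constructor
  · rintro ⟨hB, hmax⟩
    obtain ⟨i, hi⟩ := hs.exists_subset_of_properBlock hI hirr hB
    exact ⟨i, (hmax _ (hs.properBlock_part hI hk i) fun a ha =>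
      LTree.mem_leafFinset.2 (hi a ha)).symm⟩
  · rintro ⟨i, rfl⟩
    refine ⟨hs.properBlock_part hI hk i, fun B hB hle => hle.antisymm ?_⟩
    obtain ⟨j, hj⟩ := hs.exists_subset_of_properBlock hI hirr hB
    obtain ⟨a, ha⟩ := (s i).1.exists_mem_leafList
    rw [hs.disjoint i j a ha (hj a (hle (LTree.mem_leafFinset.2 ha)))]
    exact fun a ha => LTree.mem_leafFinset.2 (hj a ha)

theorem leafFinset_injective (hs : LeafPartition s) :
    Function.Injective fun i => (s i).1.leafFinset := by
  intro i j hij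
  obtain ⟨a, ha⟩ := (s i).1.exists_mem_leafList
  exact hs.disjoint i j a ha
    (LTree.mem_leafFinset.1 ((Finset.ext_iff.1 hij a).1 (LTree.mem_leafFinset.2 ha)))

theorem irrSize_compose (hs : LeafPartition s) (hI : ValidPair k I) (hirr : IrredPair k I)
    (hk : 2 ≤ k) : irrSize n (compose I s) = k := by
  have hn : ¬ n ≤ 1 := fun hn => by
    have h : Subsingleton (Fin n) := Fin.subsingleton_iff_le_one.2 hn
    obtain ⟨a, ha⟩ := (s ⟨0, by omega⟩).1.exists_mem_leafList
    obtain ⟨b, hb⟩ := (s ⟨1, by omega⟩).1.exists_mem_leafList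
    have := hs.disjoint _ _ a ha (Subsingleton.elim b a ▸ hb)
    simp at this
  have : {B | MaxBlock n (compose I s) B} =
      (fun i => (s i).1.leafFinset) '' Set.univ := by
    ext B
    simp [hs.maxBlock_compose_iff hI hirr hk]
  rw [irrSize, if_neg hn, this, Set.ncard_image_of_injective _ hs.leafFinset_injective,
    Set.ncard_univ, Nat.card_fin]

end Blocks

end LeafPartition

end Tanglegram

section Decomposition

variable {n k : ℕ}

theorem ProperBlock.image {p q : LTree (Fin n) × LTree (Fin n)} {B : Finset (Fin n)}
    (hB : ProperBlock n p B) {f : Fin n → Fin n} (hf : Function.Injective f)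
    (h1 : TreeRel f p.1 q.1) (h2 : TreeRel f p.2 q.2) : ProperBlock n q (B.image f) := by
  obtain ⟨⟨⟨u, hu, huB⟩, v, hv, hvB⟩, hBne⟩ := hB
  obtain ⟨u', hu', huu⟩ := h1.exists_isSub hu
  obtain ⟨v', hv', hvv⟩ := h2.exists_isSub hv
  have key : ∀ {w w' : LTree (Fin n)}, TreeRel f w w' → w.leafFinset = B →
      w'.leafFinset = B.image f := by
    rintro w w' h rfl
    ext b
    simp [LTree.mem_leafFinset, ← h.perm.mem_iff]
  refine ⟨⟨⟨u', hu', key huu huB⟩, v', hv', key hvv hvB⟩, fun h => hBne ?_⟩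
  rw [← Finset.card_eq_iff_eq_univ, ← Finset.card_image_of_injective B hf, h, Finset.card_univ]

theorem IrredPair.of_pairIso {p q : LTree (Fin n) × LTree (Fin n)} (hp : IrredPair n p)
    (h : PairIso q p) : IrredPair n q := by
  rintro ⟨B, hB, hcard⟩
  obtain ⟨f, hf, h1, h2⟩ := h
  exact hp ⟨_, hB.image hf h1 h2, by rwa [Finset.card_image_of_injective B hf]⟩

theorem exists_iso_of_compose_pairIso {s s' : Fin k → LTree (Fin n) × LTree (Fin n)}
    {I J : LTree (Fin k) × LTree (Fin k)} (hs : LeafPartition s) (hs' : LeafPartition s')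
    (hI : ValidPair k I) (hJ : ValidPair k J) (hIirr : IrredPair k I) (hJirr : IrredPair k J)
    (hk : 2 ≤ k) (h : PairIso (compose I s) (compose J s')) :
    ∃ f : Fin k → Fin k, Function.Injective f ∧ TreeRel f I.1 J.1 ∧ TreeRel f I.2 J.2 ∧
      ∀ i, TanglegramIso (s i) (s' (f i)) := by
  obtain ⟨g, hg, h1, h2⟩ := h
  obtain ⟨g', hg', hg''⟩ := Function.bijective_iff_has_inverse.1
    (Finite.injective_iff_bijective.1 hg)
  have hf : ∀ i, ∃ j, ∀ a ∈ (s i).1.leafList, g a ∈ (s' j).1.leafList := fun i => by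
    obtain ⟨j, hj⟩ := hs'.exists_subset_of_properBlock hJ hJirr
      ((hs.properBlock_part hI hk i).image hg h1 h2)
    exact ⟨j, fun a ha => hj _ (Finset.mem_image_of_mem g (LTree.mem_leafFinset.2 ha))⟩
  have hf' : ∀ j, ∃ i, ∀ a ∈ (s' j).1.leafList, g' a ∈ (s i).1.leafList := fun j => by
    obtain ⟨i, hi⟩ := hs.exists_subset_of_properBlock hI hIirr
      ((hs'.properBlock_part hJ hk j).image hg''.injective (h1.symm fun a _ => hg' a)
        (h2.symm fun a _ => hg' a))
    exact ⟨i, fun a ha => hi _ (Finset.mem_image_of_mem g' (LTree.mem_leafFinset.2 ha))⟩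
  choose f hf using hf
  choose f' hf' using hf'
  have hff : Function.LeftInverse f' f := fun i => by
    obtain ⟨a, ha⟩ := (s i).1.exists_mem_leafList
    have := hf' _ _ (hf i a ha)
    rw [hg'] at this
    exact hs.disjoint _ _ a this ha
  have hmem : ∀ i b, b ∈ (s' (f i)).1.leafList → ∃ a ∈ (s i).1.leafList, g a = b :=
    fun i b hb => ⟨g' b, by simpa [hff i] using hf' _ b hb, hg'' b⟩
  refine ⟨f, hff.injective, h1.of_bind (fun i _ => hf i) hs'.disjoint hff.injective
    hI.isTanglegram.1 hJ.isTanglegram.1, h2.of_bind (fun i _ a ha => ?_) hs'.disjoint_snd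
    hff.injective hI.isTanglegram.nodup_snd hJ.isTanglegram.nodup_snd, fun i => ⟨g, ?_, ?_⟩⟩
  · exact hs'.mem_iff.2 (hf i a (hs.mem_iff.1 ha))
  · obtain ⟨u, hu, hgu⟩ := h1.exists_isSub (IsSub.bind_of_mem (hI.mem i) fun i => (s i).1)
    rwa [← IsSub.eq_of_mem_iff (hs'.validPair_compose hJ).isTanglegram.1 hu
      (IsSub.bind_of_mem (hJ.mem (f i)) fun i => (s' i).1) fun b => ⟨fun hb => ?_, fun hb => ?_⟩]
    · obtain ⟨a, ha, rfl⟩ := hgu.exists_mem hb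
      exact hf i a ha
    · obtain ⟨a, ha, rfl⟩ := hmem i b hb
      exact hgu.mem ha
  · obtain ⟨u, hu, hgu⟩ := h2.exists_isSub (IsSub.bind_of_mem (hI.mem_snd i) fun i => (s i).2)
    rwa [← IsSub.eq_of_mem_iff (hs'.validPair_compose hJ).isTanglegram.nodup_snd hu
      (IsSub.bind_of_mem (hJ.mem_snd (f i)) fun i => (s' i).2)
      fun b => ⟨fun hb => ?_, fun hb => ?_⟩]
    · obtain ⟨a, ha, rfl⟩ := hgu.exists_mem hb
      exact hs'.mem_iff.2 (hf i a (hs.mem_iff.1 ha))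
    · obtain ⟨a, ha, rfl⟩ := hmem i b (hs'.mem_iff.1 hb)
      exact hgu.mem (hs.mem_iff.2 ha)

theorem properBlock_singleton {t : LTree (Fin n) × LTree (Fin n)} (ht : ValidPair n t)
    (hn : 2 ≤ n) (a : Fin n) : ProperBlock n t {a} := by
  refine ⟨⟨⟨.leaf a, .exists_leaf (ht.mem a), ?_⟩, .leaf a, .exists_leaf (ht.mem_snd a), ?_⟩,
    fun h => ?_⟩
  · simp [LTree.leafFinset, LTree.leafList]
  · simp [LTree.leafFinset, LTree.leafList]
  · have := congrArg Finset.card h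
    simp only [Finset.card_singleton, Finset.card_univ, Fintype.card_fin] at this
    omega

theorem exists_maxBlock {t : LTree (Fin n) × LTree (Fin n)} (ht : ValidPair n t)
    (hn : 2 ≤ n) (a : Fin n) : ∃ B, MaxBlock n t B ∧ a ∈ B := by
  obtain ⟨B, hle, hB⟩ := (Set.toFinite {B | ProperBlock n t B}).exists_le_maximal
    (properBlock_singleton ht hn a)
  exact ⟨B, ⟨hB.1, fun B' hB' h => h.antisymm (hB.2 hB' h)⟩, by simpa using hle⟩

theorem MaxBlock.eq_of_mem {t : LTree (Fin n) × LTree (Fin n)} (ht : ValidPair n t)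
    {B B' : Finset (Fin n)} (hB : MaxBlock n t B) (hB' : MaxBlock n t B') {a : Fin n}
    (ha : a ∈ B) (ha' : a ∈ B') : B = B' := by
  obtain ⟨u, hu, huB⟩ := hB.1.1.1
  obtain ⟨v, hv, hvB⟩ := hB'.1.1.1
  have hsub : ∀ {w w' : LTree (Fin n)}, IsSub w w' → w.leafFinset ⊆ w'.leafFinset :=
    fun h a ha => LTree.mem_leafFinset.2 (h.mem (LTree.mem_leafFinset.1 ha))
  rcases hu.total_of_mem ht.isTanglegram.1 hv (LTree.mem_leafFinset.1 (huB ▸ ha))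
    (LTree.mem_leafFinset.1 (hvB ▸ ha')) with h | h
  · exact hB.2 _ hB'.1 (huB ▸ hvB ▸ hsub h)
  · exact (hB'.2 _ hB.1 (huB ▸ hvB ▸ hsub h)).symm

/-- Every tanglegram is a composition over an irreducible tanglegram. -/
theorem exists_decomposition {t : LTree (Fin n) × LTree (Fin n)} (ht : ValidPair n t)
    (hn : 2 ≤ n) (hk : irrSize n t = k) :
    2 ≤ k ∧ ∃ (I : LTree (Fin k) × LTree (Fin k)) (s : Fin k → LTree (Fin n) × LTree (Fin n)),
      ValidPair k I ∧ IrredPair k I ∧ LeafPartition s ∧ compose I s = t := by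
  rw [irrSize, if_neg (by omega)] at hk
  let e : {B | MaxBlock n t B} ≃ Fin k := Finite.equivFinOfCardEq hk
  choose u hu huB using fun i => (e.symm i).2.1.1.1
  choose v hv hvB using fun i => (e.symm i).2.1.1.2
  have hmem : ∀ i a, a ∈ (u i).leafList ↔ a ∈ (e.symm i).1 := fun i a => by
    rw [← huB, LTree.mem_leafFinset]
  have hmem' : ∀ i a, a ∈ (v i).leafList ↔ a ∈ (e.symm i).1 := fun i a => by
    rw [← hvB, LTree.mem_leafFinset]
  have hcov : ∀ a, ∃ i, a ∈ (e.symm i).1 := fun a => by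
    obtain ⟨B, hB, ha⟩ := exists_maxBlock ht hn a
    exact ⟨e ⟨B, hB⟩, by simpa using ha⟩
  have hs : LeafPartition fun i => (u i, v i) := by
    refine ⟨fun i => ?_, fun i j a hi hj => ?_, fun a => ?_⟩
    · have hun := (hu i).nodup ht.isTanglegram.1
      have hvn := (hv i).nodup ht.isTanglegram.nodup_snd
      exact ⟨hun, (List.perm_ext_iff_of_nodup hun hvn).2 fun a => by rw [hmem, hmem']⟩
    · exact e.symm.injective (Subtype.ext ((e.symm i).2.eq_of_mem ht (e.symm j).2
        ((hmem i a).1 hi) ((hmem j a).1 hj)))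
    · simpa only [hmem] using hcov a
  obtain ⟨I, hI, rfl⟩ := hs.exists_compose_eq ht hu hv
  refine ⟨?_, I, _, hI, ?_, hs, rfl⟩
  · by_contra hk2
    have : Subsingleton (Fin k) := Fin.subsingleton_iff_le_one.2 (by omega)
    obtain ⟨i, -⟩ := hcov ⟨0, by omega⟩
    refine (e.symm i).2.1.2 (Finset.eq_univ_iff_forall.2 fun a => ?_)
    obtain ⟨j, hj⟩ := hcov a
    rwa [Subsingleton.elim i j]
  · rintro ⟨C, ⟨⟨⟨p, hp, hpC⟩, q, hq, hqC⟩, hC⟩, hcard⟩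
    have hpC' : ∀ i, i ∈ p.leafList ↔ i ∈ C := fun i => by rw [← hpC, LTree.mem_leafFinset]
    have hqC' : ∀ i, i ∈ q.leafList ↔ i ∈ C := fun i => by rw [← hqC, LTree.mem_leafFinset]
    obtain ⟨j, hj⟩ := not_forall.1 (mt Finset.eq_univ_iff_forall.2 hC)
    obtain ⟨b, hb⟩ := (u j).exists_mem_leafList
    have hmemB : ∀ a, a ∈ (p.bind u).leafFinset ↔ ∃ i ∈ C, a ∈ (e.symm i).1 := fun a => by
      simp only [LTree.mem_leafFinset, LTree.mem_leafList_bind, hpC', hmem]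
    have hblock : ProperBlock n (compose I fun i => (u i, v i)) (p.bind u).leafFinset := by
      refine ⟨⟨⟨_, hp.bind u, rfl⟩, _, hq.bind v, ?_⟩, fun h => ?_⟩
      · ext a
        rw [hmemB]
        simp only [LTree.mem_leafFinset, LTree.mem_leafList_bind, hqC', hmem']
      · obtain ⟨i, hi, hbi⟩ := (hmemB b).1 (h ▸ Finset.mem_univ b)
        exact hj (hs.disjoint i j b ((hmem i b).2 hbi) hb ▸ hi)
    obtain ⟨i, hi, i', hi', hne⟩ := Finset.one_lt_card.1 hcard
    have heq := (e.symm i).2.2 _ hblock fun a ha => (hmemB a).2 ⟨i, hi, ha⟩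
    obtain ⟨a, ha⟩ := (u i').exists_mem_leafList
    refine hne (hs.disjoint i i' a ((hmem i a).2 ?_) ha)
    rw [heq]
    exact (hmemB a).2 ⟨i', hi', (hmem i' a).1 ha⟩

end Decomposition

section Rigidity

/-- If all leaves of a subtree are moved by `f` and the first leaf moved by `f` is one of them,
then the leaves of the subtree start at that leaf. -/
theorem IsSub.prefix_of_first_moved {α : Type} {f : α → α} {t u : LTree α} {pre post : List α}
    {x : α} (ht : t.leafList = pre ++ x :: post) (hpre : ∀ y ∈ pre, f y = y)
    (hnd : t.leafList.Nodup) (hu : IsSub u t) (hx : x ∈ u.leafList)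
    (hmoved : ∀ y ∈ u.leafList, f y ≠ y) : u.leafList <+: x :: post := by
  obtain ⟨a, b, hab⟩ := hu.isInfix
  rw [ht, List.append_assoc] at hab
  rw [ht] at hnd
  obtain ⟨c, rfl, hc⟩ | ⟨c, rfl, hc⟩ := List.append_eq_append_iff.1 hab
  · cases c with
    | nil => exact ⟨b, hc⟩
    | cons y c =>
      have hcu := hc
      obtain ⟨z, l, hz⟩ := List.exists_cons_of_ne_nil
        (List.ne_nil_of_length_pos u.leafList_length_pos)
      rw [hz, List.cons_append, List.cons_append, List.cons.injEq] at hcu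
      exact absurd (hpre y (by simp)) (hmoved y (by simp [hz, hcu.1]))
  · cases c with
    | nil => exact ⟨b, hc.symm⟩
    | cons y c =>
      rw [List.cons_append, List.cons.injEq] at hc
      obtain ⟨rfl, rfl⟩ := hc
      simp only [List.nodup_append, List.nodup_cons, List.mem_append] at hnd
      exact absurd (Or.inr (Or.inl hx)) hnd.2.1.1

variable {α : Type} {f : α → α}

theorem TreeRel.mem_node_of_swapped {l r : LTree α} (h1 : TreeRel f l r) (h2 : TreeRel f r l)
    {y : α} (hy : y ∈ (LTree.node l r).leafList) : f y ∈ (LTree.node l r).leafList :=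
  (TreeRel.swap h1 h2).mem hy

theorem TreeRel.ne_of_swapped {l r : LTree α} (h1 : TreeRel f l r) (h2 : TreeRel f r l)
    (hnd : (LTree.node l r).leafList.Nodup) {y : α} (hy : y ∈ (LTree.node l r).leafList) :
    f y ≠ y := by
  intro hfy
  have hlr := (LTree.nodup_node.1 hnd).2.2
  rcases List.mem_append.1 hy with hy | hy
  · exact hlr y hy (hfy ▸ h1.mem hy)
  · exact hlr y (hfy ▸ h2.mem hy) hy

theorem TreeRel.leafList_eq_of_swapped {l r l' r' : LTree α} {L : List α} {x : α}
    (h1 : TreeRel f l r) (h2 : TreeRel f r l) (h1' : TreeRel f l' r')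
    (hx : x ∈ (LTree.node l r).leafList)
    (hu : (LTree.node l r).leafList <+: L) (hv : (LTree.node l' r').leafList <+: L)
    (hnd : (LTree.node l' r').leafList.Nodup)
    (hle : (LTree.node l r).leafList.length ≤ (LTree.node l' r').leafList.length) :
    (LTree.node l r).leafList = (LTree.node l' r').leafList := by
  have huv := List.prefix_of_prefix_length_le hu hv hle
  have hl' : l'.leafList <+: (LTree.node l' r').leafList := List.prefix_append _ _
  rcases List.prefix_or_prefix_of_prefix huv hl' with h | h
  · have hfx := h.subset (TreeRel.mem_node_of_swapped h1 h2 hx)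
    exact absurd (h1'.mem (h.subset hx)) ((LTree.nodup_node.1 hnd).2.2 _ hfx)
  · refine huv.eq_of_length (hle.antisymm (hnd.subperm fun y hy => ?_).length_le)
    rcases List.mem_append.1 hy with hy | hy
    · exact h.subset hy
    · obtain ⟨z, hz, rfl⟩ := h1'.exists_mem hy
      exact TreeRel.mem_node_of_swapped h1 h2 (h.subset hz)

theorem eq_self_of_layout {k : ℕ} {f : Fin k → Fin k} {I : LTree (Fin k) × LTree (Fin k)}
    (hI : ValidPair k I) (hirr : IrredPair k I) (hk : 3 ≤ k)
    (hlay : I.1.leafList = I.2.leafList) (h1 : TreeRel f I.1 I.1) (h2 : TreeRel f I.2 I.2)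
    (x : Fin k) : f x = x := by
  by_contra hx
  obtain ⟨y, hy⟩ := Option.isSome_iff_exists.1
    (List.find?_isSome (p := fun x => f x ≠ x).2 ⟨x, hI.mem x, by simpa using hx⟩)
  obtain ⟨hy, pre, post, hL, hpre⟩ := List.find?_eq_some_iff_append.1 hy
  simp only [ne_eq, decide_not, Bool.not_not, decide_eq_true_eq, Bool.not_eq_true',
    decide_eq_false_iff_not] at hy hpre
  have hnd1 := hI.isTanglegram.1
  have hnd2 := hI.isTanglegram.nodup_snd
  obtain ⟨l, r, hu, hyu, hlr, hrl⟩ := h1.exists_swapped (hI.mem y) hy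
  obtain ⟨l', r', hv, hyv, hlr', hrl'⟩ := h2.exists_swapped (hI.mem_snd y) hy
  have hun := hu.nodup hnd1
  have hvn := hv.nodup hnd2
  have hup := hu.prefix_of_first_moved hL hpre hnd1 hyu fun z hz => hlr.ne_of_swapped hrl hun hz
  have hvp := hv.prefix_of_first_moved (hlay ▸ hL) hpre hnd2 hyv
    fun z hz => hlr'.ne_of_swapped hrl' hvn hz
  have heq : (LTree.node l r).leafList = (LTree.node l' r').leafList := by
    rcases le_total (LTree.node l r).leafList.length (LTree.node l' r').leafList.length with h | h
    · exact hlr.leafList_eq_of_swapped hrl hlr' hyu hup hvp hvn h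
    · exact (hlr'.leafList_eq_of_swapped hrl' hlr hyv hvp hup hun h).symm
  have hlen := hlr.length_eq
  have hlen' := hlr'.length_eq
  have heql : l.leafList = l'.leafList := by
    refine (List.append_inj heq ?_).1
    have := congrArg List.length heq
    simp only [LTree.leafList, List.length_append] at this
    omega
  have hsmall : ∀ {w w' : LTree (Fin k)}, IsSub w I.1 → IsSub w' I.2 →
      w.leafList = w'.leafList → w.leafList.length ≤ 1 ∨ w.leafList.length = k := by
    intro w w' hw hw' hww
    have hcard := List.toFinset_card_of_nodup (hw.nodup hnd1)
    by_contra hcon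
    refine hirr ⟨w.leafFinset, ⟨⟨⟨w, hw, rfl⟩, w', hw', by rw [LTree.leafFinset, ← hww]; rfl⟩,
      fun h => ?_⟩, ?_⟩
    · rw [← LTree.leafFinset, h, Finset.card_univ, Fintype.card_fin] at hcard
      omega
    · rw [LTree.leafFinset]
      omega
  have hsu := hsmall hu hv heq
  have hsl := hsmall ((IsSub.left r (.refl l)).trans hu) ((IsSub.left r' (.refl l')).trans hv) heql
  have hpos := l.leafList_length_pos
  simp only [LTree.leafList, List.length_append] at hsu
  omega

/-- An irreducible planar tanglegram of size at least three has no nontrivial automorphism. -/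
theorem IrredPair.eq_self_of_automorphism {k : ℕ} {f : Fin k → Fin k}
    {I : LTree (Fin k) × LTree (Fin k)} (hirr : IrredPair k I) (hI : ValidPair k I)
    (hpl : HasPlanarLayout I) (hk : 3 ≤ k) (h1 : TreeRel f I.1 I.1) (h2 : TreeRel f I.2 I.2)
    (x : Fin k) : f x = x := by
  obtain ⟨J, hJ1, hJ2, hJ⟩ := hpl
  exact eq_self_of_layout (I := J) ⟨hJ1.perm_id.symm.trans hI.1, hJ2.perm_id.symm.trans hI.2⟩
    (hirr.of_pairIso ⟨id, Function.injective_id, hJ1.symm_id, hJ2.symm_id⟩) hk hJ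
    ((hJ1.symm_id.trans h1).trans hJ1) ((hJ2.symm_id.trans h2).trans hJ2) x

end Rigidity

section Counting

/-- Isomorphism classes of planar tanglegrams of size `n` satisfying `P`. -/
abbrev TangClass (n : ℕ) (P : LTree (Fin n) × LTree (Fin n) → Prop) : Type :=
  Quot fun a b : {p : LTree (Fin n) × LTree (Fin n) //
    ValidPair n p ∧ PlanarPair n p ∧ P p} => PairIso a.1 b.1

theorem TangClass.mk_eq_iff {n : ℕ} {P : LTree (Fin n) × LTree (Fin n) → Prop}
    {a b : {p : LTree (Fin n) × LTree (Fin n) // ValidPair n p ∧ PlanarPair n p ∧ P p}} :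
    (Quot.mk _ a : TangClass n P) = Quot.mk _ b ↔ TanglegramIso a.1 b.1 := by
  have hE : Equivalence fun a b : {p : LTree (Fin n) × LTree (Fin n) //
      ValidPair n p ∧ PlanarPair n p ∧ P p} => PairIso a.1 b.1 := by
    refine ⟨fun a => ?_, fun {a b} h => ?_, fun {a b c} h h' => ?_⟩
    · exact (pairIso_iff a.2.1 a.2.1).2 (.refl _)
    · exact (pairIso_iff b.2.1 a.2.1).2 (((pairIso_iff a.2.1 b.2.1).1 h).symm
        a.2.1.isTanglegram b.2.1.isTanglegram)
    · exact (pairIso_iff a.2.1 c.2.1).2 (((pairIso_iff a.2.1 b.2.1).1 h).trans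
        ((pairIso_iff b.2.1 c.2.1).1 h'))
  rw [← pairIso_iff a.2.1 b.2.1]
  exact Quot.eq.trans (iff_of_eq (congrFun (congrFun hE.eqvGen_eq a) b))

instance TangClass.finite (n : ℕ) (P : LTree (Fin n) × LTree (Fin n) → Prop) :
    Finite (TangClass n P) := by
  have hfin := LTree.finite_leafList_length_le (α := Fin n) n
  have : Finite {p : LTree (Fin n) × LTree (Fin n) //
      ValidPair n p ∧ PlanarPair n p ∧ P p} := by
    refine ((hfin.prod hfin).subset ?_ :
      {p | ValidPair n p ∧ PlanarPair n p ∧ P p}.Finite).to_subtype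
    rintro p ⟨⟨h1, h2⟩, -⟩
    have h1 := h1.length_eq
    have h2 := h2.length_eq
    simp only [List.length_finRange] at h1 h2
    exact ⟨h1.le, h2.le⟩
  exact Quot.finite _

/-- Isomorphism classes of planar tanglegrams of arbitrary size. -/
abbrev SizedClass : Type := Σ m, TangClass m fun _ => True

/-- The tanglegram `s`, on any label type, belongs to the isomorphism class `x`. -/
def HasClass {α : Type} (s : LTree α × LTree α) (x : SizedClass) : Prop :=
  IsTanglegram s ∧ TanglegramIso x.2.out.1 s

namespace HasClass

variable {α β : Type} {s : LTree α × LTree α} {s' : LTree β × LTree β} {x y : SizedClass}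

theorem length_eq (h : HasClass s x) : s.1.leafList.length = x.1 := by
  obtain ⟨-, f, h1, -⟩ := h
  rw [← h1.length_eq, x.2.out.2.1.length]

theorem hasPlanarLayout (h : HasClass s x) : HasPlanarLayout s :=
  ((planarPair_iff x.2.out.2.1).1 x.2.out.2.2.1).of_iso h.1 h.2 x.2.out.2.1.isTanglegram

theorem iso (h : HasClass s x) (h' : HasClass s' x) : TanglegramIso s s' :=
  (h.2.symm x.2.out.2.1.isTanglegram h.1).trans h'.2

theorem eq_of_iso (h : HasClass s x) (h' : HasClass s' y) (hs : TanglegramIso s s') : x = y := by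
  have hl := h.length_eq
  obtain ⟨f, hf, -⟩ := id hs
  rw [hf.length_eq, h'.length_eq] at hl
  obtain ⟨m, x⟩ := x
  obtain ⟨m', y⟩ := y
  dsimp only at hl
  subst hl
  have := TangClass.mk_eq_iff.2
    ((h.2.trans hs).trans (h'.2.symm y.out.2.1.isTanglegram h'.1))
  rw [Quot.out_eq, Quot.out_eq] at this
  exact congrArg (Sigma.mk _) this

theorem _root_.HasPlanarLayout.exists_hasClass (h : HasPlanarLayout s) (hs : IsTanglegram s) :
    ∃ x, HasClass s x := by
  let f : Fin s.1.leafList.length → α := s.1.leafList.get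
  have hf : Function.Injective f := List.nodup_iff_injective_get.1 hs.1
  have hne : Nonempty (Fin s.1.leafList.length) := ⟨⟨0, s.1.leafList_length_pos⟩⟩
  have hfg : ∀ a ∈ s.1.leafList, f (Function.invFun f a) = a := fun a ha =>
    Function.invFun_eq (List.mem_iff_get.1 ha)
  let p := (s.1.map (Function.invFun f), s.2.map (Function.invFun f))
  have hps : TanglegramIso p s := ⟨f, (TreeRel.of_map _ s.1).symm hfg,
    (TreeRel.of_map _ s.2).symm fun a ha => hfg a (hs.mem_iff.2 ha)⟩
  have hpt : IsTanglegram p := by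
    refine ⟨?_, ?_⟩
    · rw [LTree.leafList_map]
      exact hs.1.map_on fun a ha b hb hab => by rw [← hfg a ha, hab, hfg b hb]
    · rw [LTree.leafList_map, LTree.leafList_map]
      exact hs.2.map _
  have hpv : ValidPair _ p := validPair_iff.2 ⟨hpt, fun i => by
    rw [LTree.leafList_map]
    exact List.mem_map.2 ⟨f i, List.get_mem _ _, Function.leftInverse_invFun hf i⟩⟩
  have hpp := (planarPair_iff hpv).2 (h.of_iso hpt (hps.symm hpt hs) hs)
  refine ⟨⟨_, Quot.mk _ ⟨p, hpv, hpp, trivial⟩⟩, hs, TanglegramIso.trans ?_ hps⟩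
  exact TangClass.mk_eq_iff.1 (Quot.out_eq
    (Quot.mk _ ⟨p, hpv, hpp, trivial⟩ : TangClass _ fun _ => True))

end HasClass

/-- Sequences of `k` classes of planar tanglegrams of total size `n`. -/
abbrev ClassTuple (k n : ℕ) : Type := {x : Fin k → SizedClass // ∑ i, (x i).1 = n}

theorem exists_leafPartition {k n : ℕ} (x : ClassTuple k n) :
    ∃ s : Fin k → LTree (Fin n) × LTree (Fin n), LeafPartition s ∧ ∀ i, HasClass (s i) (x.1 i) := by
  obtain ⟨x, rfl⟩ := x
  let e : (Σ i, Fin (x i).1) ≃ Fin (∑ i, (x i).1) := finSigmaFinEquiv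
  let p i := ((x i).2.out.1.1.map fun a => e ⟨i, a⟩, (x i).2.out.1.2.map fun a => e ⟨i, a⟩)
  have hmem : ∀ i b, b ∈ (p i).1.leafList ↔ ∃ a, e ⟨i, a⟩ = b := fun i b => by
    rw [LTree.leafList_map, List.mem_map]
    exact ⟨fun ⟨a, _, h⟩ => ⟨a, h⟩, fun ⟨a, h⟩ => ⟨a, (x i).2.out.2.1.mem a, h⟩⟩
  have hp : ∀ i, IsTanglegram (p i) := fun i =>
    (x i).2.out.2.1.isTanglegram.of_pairIso ⟨fun a => e ⟨i, a⟩,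
      e.injective.comp sigma_mk_injective, .of_map _ _, .of_map _ _⟩
  refine ⟨p, ⟨hp, fun i j b hi hj => ?_, fun b => ?_⟩,
    fun i => ⟨hp i, _, .of_map _ _, .of_map _ _⟩⟩
  · obtain ⟨a, rfl⟩ := (hmem i b).1 hi
    obtain ⟨c, hc⟩ := (hmem j _).1 hj
    exact (congrArg Sigma.fst (e.injective hc)).symm
  · exact ⟨(e.symm b).1, (hmem _ _).2 ⟨(e.symm b).2, e.apply_symm_apply b⟩⟩

theorem LeafPartition.sum_eq {k n : ℕ} {s : Fin k → LTree (Fin n) × LTree (Fin n)}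
    (hs : LeafPartition s) {x : Fin k → SizedClass} (hx : ∀ i, HasClass (s i) (x i)) :
    ∑ i, (x i).1 = n := by
  have hnd : ((List.finRange k).flatMap fun i => (s i).1.leafList).Nodup :=
    List.nodup_flatMap.2 ⟨fun i _ => (hs.isTanglegram i).1,
      (List.nodup_finRange k).imp fun {i j} hij a hi hj => hij (hs.disjoint i j a hi hj)⟩
  have hperm := (List.perm_ext_iff_of_nodup hnd (List.nodup_finRange n)).2 fun a => by
    simpa using hs.covers a
  have hlen := hperm.length_eq
  rw [List.length_flatMap, List.length_finRange] at hlen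
  simp only [(hx _).length_eq] at hlen
  rw [← hlen, ← List.ofFn_eq_map, List.sum_ofFn]

/-- Class sequences sorted by their sequence of sizes. -/
def classTupleEquiv (k n : ℕ) : ClassTuple k n ≃
    Σ a : Finset.Nat.antidiagonalTuple k n, ∀ i, TangClass (a.1 i) fun _ => True where
  toFun x := ⟨⟨fun i => (x.1 i).1, Finset.Nat.mem_antidiagonalTuple.2 x.2⟩, fun i => (x.1 i).2⟩
  invFun y := ⟨fun i => ⟨y.1.1 i, y.2 i⟩, Finset.Nat.mem_antidiagonalTuple.1 y.1.2⟩
  left_inv _ := rfl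
  right_inv _ := rfl

instance ClassTuple.finite (k n : ℕ) : Finite (ClassTuple k n) :=
  .of_equiv _ (classTupleEquiv k n).symm

theorem card_classTuple (k n : ℕ) : Nat.card (ClassTuple k n) =
    ∑ a ∈ Finset.Nat.antidiagonalTuple k n, ∏ i, numPlanar (a i) := by
  rw [Nat.card_congr (classTupleEquiv k n), Nat.card_sigma]
  simp only [Nat.card_pi]
  exact Finset.sum_coe_sort (Finset.Nat.antidiagonalTuple k n) fun a => ∏ i, numPlanar (a i)

/-- Composition of classes over irreducible planar tanglegrams is onto, and its fibers are the
orbits of isomorphisms between the irreducible tanglegrams. -/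
theorem exists_composition {k : ℕ} (n : ℕ) (hk : 2 ≤ k) :
    ∃ F : {I : LTree (Fin k) × LTree (Fin k) //
        ValidPair k I ∧ PlanarPair k I ∧ IrredPair k I} → ClassTuple k n →
        TangClass n fun p => irrSize n p = k,
      (∀ I J x y, F I x = F J y ↔ ∃ f : Fin k → Fin k, Function.Injective f ∧
        TreeRel f I.1.1 J.1.1 ∧ TreeRel f I.1.2 J.1.2 ∧ ∀ i, x.1 i = y.1 (f i)) ∧
      ∀ c, ∃ I x, F I x = c := by
  choose s hs hsx using fun x : ClassTuple k n => exists_leafPartition x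
  refine ⟨fun I x => Quot.mk _ ⟨compose I.1 (s x), (hs x).validPair_compose I.2.1,
    (planarPair_iff ((hs x).validPair_compose I.2.1)).2 (LeafPartition.hasPlanarLayout_compose
      ((planarPair_iff I.2.1).1 I.2.2.1) fun i => (hsx x i).hasPlanarLayout),
    (hs x).irrSize_compose I.2.1 I.2.2.2 hk⟩, fun I J x y => ?_, fun c => ?_⟩
  · rw [TangClass.mk_eq_iff]
    constructor
    · intro h
      obtain ⟨f, hf, h1, h2, hi⟩ := exists_iso_of_compose_pairIso (hs x) (hs y) I.2.1 J.2.1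
        I.2.2.2 J.2.2.2 hk ((pairIso_iff ((hs x).validPair_compose I.2.1)
          ((hs y).validPair_compose J.2.1)).2 h)
      exact ⟨f, hf, h1, h2, fun i => (hsx x i).eq_of_iso (hsx y (f i)) (hi i)⟩
    · rintro ⟨f, -, h1, h2, hi⟩
      exact (hs x).iso_compose h1 h2 fun i => (hsx x i).iso (hi i ▸ hsx y (f i))
  · obtain ⟨⟨t, ht, hpl, hirr⟩, rfl⟩ := Quot.exists_rep c
    have hn : 2 ≤ n := by
      by_contra hn
      rw [irrSize, if_pos (by omega)] at hirr
      omega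
    obtain ⟨-, I, r, hI, hIirr, hr, rfl⟩ := exists_decomposition ht hn hirr
    obtain ⟨hIp, hrp⟩ := hr.hasPlanarLayout_of_compose hI ((planarPair_iff ht).1 hpl)
    choose x hx using fun i => (hrp i).exists_hasClass (hr.isTanglegram i)
    refine ⟨⟨I, hI, (planarPair_iff hI).2 hIp, hIirr⟩, ⟨x, hr.sum_eq hx⟩, ?_⟩
    exact TangClass.mk_eq_iff.2 ((hs _).iso_compose (f := id) (.rfl_id _) (.rfl_id _)
      fun i => (hsx _ i).iso (hx i))

theorem card_irr_of_three_le {k : ℕ} (n : ℕ) (hk : 3 ≤ k) :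
    numPlanarIrr n k = numIrred k * Nat.card (ClassTuple k n) := by
  obtain ⟨F, hF, hsurj⟩ := exists_composition (k := k) n (by omega)
  have hbij : Function.Bijective fun z : (TangClass k fun p => IrredPair k p) × ClassTuple k n =>
      F z.1.out z.2 := by
    constructor
    · rintro ⟨c, x⟩ ⟨c', y⟩ h
      obtain ⟨f, hf, h1, h2, hxy⟩ := (hF _ _ _ _).1 h
      have hc := TangClass.mk_eq_iff.2 ⟨f, h1, h2⟩
      rw [Quot.out_eq, Quot.out_eq] at hc
      dsimp only at hc
      subst hc
      have hid := c.out.2.2.2.eq_self_of_automorphism c.out.2.1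
        ((planarPair_iff c.out.2.1).1 c.out.2.2.1) hk h1 h2
      exact Prod.ext rfl (Subtype.ext (funext fun i => by rw [hxy i, hid i]))
    · intro d
      obtain ⟨I, x, rfl⟩ := hsurj d
      let c : TangClass k fun p => IrredPair k p := Quot.mk _ I
      obtain ⟨f, hf, h1, h2⟩ := (pairIso_iff c.out.2.1 I.2.1).2
        (TangClass.mk_eq_iff.1 (Quot.out_eq c))
      refine ⟨(c, ⟨fun i => x.1 (f i), ?_⟩), (hF _ _ _ _).2 ⟨f, hf, h1, h2, fun i => rfl⟩⟩
      exact ((Finite.injective_iff_bijective.1 hf).sum_comp fun i => (x.1 i).1).trans x.2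
  exact (Nat.card_eq_of_bijective _ hbij).symm.trans (Nat.card_prod _ _)

/-- Counting the orbits of an involution. -/
theorem two_mul_card_of_involution {X Y : Type} [Finite X] {σ : X → X} {G : X → Y}
    (hG : ∀ x y, G x = G y ↔ y = x ∨ y = σ x) (hsurj : Function.Surjective G) :
    2 * Nat.card Y = Nat.card X + Nat.card {x // σ x = x} := by
  classical
  have := Fintype.ofFinite X
  have := Finite.of_surjective G hsurj
  have := Fintype.ofFinite Y
  rw [Nat.card_eq_fintype_card, Nat.card_eq_fintype_card, Nat.card_eq_fintype_card,
    Fintype.card_subtype, ← Finset.card_univ (α := X),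
    Finset.card_eq_sum_card_fiberwise (f := G) (t := Finset.univ) (by simp),
    Finset.card_eq_sum_card_fiberwise (s := {x | σ x = x}) (f := G) (t := Finset.univ) (by simp),
    ← Finset.sum_add_distrib, mul_comm, ← smul_eq_mul, ← Finset.card_univ, ← Finset.sum_const]
  refine Finset.sum_congr rfl fun y _ => ?_
  obtain ⟨x, rfl⟩ := hsurj y
  have hfib : ({z | G z = G x} : Finset X) = {x, σ x} := by
    ext z
    simp only [Finset.mem_filter, Finset.mem_univ, true_and, Finset.mem_insert,
      Finset.mem_singleton]
    exact eq_comm.trans (hG x z)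
  rw [hfib, Finset.filter_comm, hfib]
  by_cases hx : σ x = x
  · simp [hx, Finset.filter_singleton]
  · have hσ : σ (σ x) ≠ σ x := by
      rcases (hG (σ x) x).1 ((hG x (σ x)).2 (.inr rfl)).symm with h | h
      · exact absurd h.symm hx
      · rw [← h]
        exact Ne.symm hx
    simp [Finset.filter_insert, Finset.filter_singleton, hx, hσ, Finset.card_pair (Ne.symm hx)]

theorem card_fixed_classTuple (n : ℕ) :
    Nat.card {x : ClassTuple 2 n // x.1 0 = x.1 1} = if Even n then numPlanar (n / 2) else 0 := by
  split_ifs with hn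
  · obtain ⟨m, rfl⟩ := hn
    rw [← two_mul, Nat.mul_div_cancel_left m two_pos]
    refine (Nat.card_eq_of_bijective (fun c : TangClass m fun _ => True =>
      (⟨⟨fun _ => ⟨m, c⟩, by simp⟩, rfl⟩ :
        {x : ClassTuple 2 (2 * m) // x.1 0 = x.1 1})) ⟨fun c d h => ?_, ?_⟩).symm
    · have h := congrFun (congrArg (fun x => x.1.1) h) 0
      exact eq_of_heq (Sigma.mk.inj h).2
    · rintro ⟨⟨x, hx⟩, h01⟩
      rw [Fin.sum_univ_two] at hx
      dsimp only at h01
      have hm : (x 0).1 = m := by rw [← h01] at hx; omega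
      obtain ⟨c, hc⟩ : ∃ c, x 0 = ⟨m, c⟩ := by
        subst hm
        exact ⟨(x 0).2, rfl⟩
      refine ⟨c, Subtype.ext (Subtype.ext (funext fun i => ?_))⟩
      fin_cases i
      · exact hc.symm
      · exact hc.symm.trans h01
  · have : IsEmpty {x : ClassTuple 2 n // x.1 0 = x.1 1} := ⟨fun ⟨⟨x, hx⟩, h01⟩ => hn ?_⟩
    · exact Nat.card_of_isEmpty
    · rw [Fin.sum_univ_two] at hx
      dsimp only at h01
      rw [← hx, h01]
      exact ⟨_, rfl⟩

theorem treeRel_of_two {f : Fin 2 → Fin 2} (hf : Function.Injective f) {t t' : LTree (Fin 2)}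
    (ht : t.leafList.Perm (List.finRange 2)) (ht' : t'.leafList.Perm (List.finRange 2)) :
    TreeRel f t t' := by
  have key : ∀ {t : LTree (Fin 2)}, t.leafList.Perm (List.finRange 2) →
      ∃ a b, a ≠ b ∧ t = .node (.leaf a) (.leaf b) := by
    intro t ht
    have hlen := ht.length_eq
    have hnd := ht.nodup_iff.2 (List.nodup_finRange 2)
    simp only [List.length_finRange] at hlen
    cases t with
    | leaf a => simp [LTree.leafList] at hlen
    | node l r =>
      have := l.leafList_length_pos
      have := r.leafList_length_pos
      simp only [LTree.leafList, List.length_append] at hlen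
      obtain ⟨a, rfl⟩ := LTree.eq_leaf_of_length_le_one (t := l) (by omega)
      obtain ⟨b, rfl⟩ := LTree.eq_leaf_of_length_le_one (t := r) (by omega)
      exact ⟨a, b, by simpa [LTree.leafList] using hnd, rfl⟩
  obtain ⟨a, b, hab, rfl⟩ := key ht
  obtain ⟨c, d, hcd, rfl⟩ := key ht'
  have hfab := hf.ne hab
  have : (c = f a ∧ d = f b) ∨ (c = f b ∧ d = f a) := by omega
  rcases this with ⟨rfl, rfl⟩ | ⟨rfl, rfl⟩
  · exact .node (.leaf a) (.leaf b)
  · exact .swap (.leaf a) (.leaf b)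

theorem two_mul_card_irr_two (n : ℕ) :
    2 * numPlanarIrr n 2 = Nat.card (ClassTuple 2 n) +
      if Even n then numPlanar (n / 2) else 0 := by
  obtain ⟨F, hF, hsurj⟩ := exists_composition (k := 2) n le_rfl
  let t : LTree (Fin 2) := .node (.leaf 0) (.leaf 1)
  have ht : ValidPair 2 (t, t) := ⟨.refl _, .refl _⟩
  let I : {I : LTree (Fin 2) × LTree (Fin 2) // ValidPair 2 I ∧ PlanarPair 2 I ∧ IrredPair 2 I} :=
    ⟨(t, t), ht, (planarPair_iff ht).2 ⟨(t, t), .rfl_id _, .rfl_id _, rfl⟩, fun ⟨B, hB, hcard⟩ =>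
      hB.2 ((Finset.card_eq_iff_eq_univ B).1 (B.card_le_univ.antisymm (by simpa using hcard)))⟩
  let σ : ClassTuple 2 n → ClassTuple 2 n := fun x =>
    ⟨fun i => x.1 (Equiv.swap 0 1 i),
      (Equiv.sum_comp (Equiv.swap 0 1) fun i => (x.1 i).1).trans x.2⟩
  have hG : ∀ x y, F I x = F I y ↔ y = x ∨ y = σ x := by
    intro x y
    rw [hF]
    constructor
    · rintro ⟨f, hf, -, -, h⟩
      have h01 := hf.ne (show (0 : Fin 2) ≠ 1 by decide)
      have : (f 0 = 0 ∧ f 1 = 1) ∨ (f 0 = 1 ∧ f 1 = 0) := by omega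
      have h0 := h 0
      have h1 := h 1
      rcases this with ⟨e0, e1⟩ | ⟨e0, e1⟩ <;> rw [e0] at h0 <;> rw [e1] at h1
      · refine .inl (Subtype.ext (funext fun i => ?_))
        fin_cases i
        · exact h0.symm
        · exact h1.symm
      · refine .inr (Subtype.ext (funext fun i => ?_))
        fin_cases i
        · exact h1.symm
        · exact h0.symm
    · rintro (rfl | rfl)
      · exact ⟨id, Function.injective_id, .rfl_id _, .rfl_id _, fun _ => rfl⟩
      · exact ⟨Equiv.swap 0 1, Equiv.injective _, treeRel_of_two (Equiv.injective _) ht.1 ht.1,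
          treeRel_of_two (Equiv.injective _) ht.1 ht.1, fun i => by simp [σ]⟩
  have hsurj' : Function.Surjective (F I) := by
    intro c
    obtain ⟨J, x, rfl⟩ := hsurj c
    exact ⟨x, (hF _ _ _ _).2 ⟨id, Function.injective_id,
      treeRel_of_two Function.injective_id ht.1 J.2.1.1,
      treeRel_of_two Function.injective_id ht.1 J.2.1.2, fun _ => rfl⟩⟩
  have hfix : ∀ x, σ x = x ↔ x.1 0 = x.1 1 := fun x => by
    constructor
    · intro h
      exact (congrFun (congrArg Subtype.val h) 1 : _)
    · intro h
      refine Subtype.ext (funext fun i => ?_)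
      fin_cases i
      · exact h.symm
      · exact h
  rw [← card_fixed_classTuple, ← Nat.card_congr (Equiv.subtypeEquivRight hfix)]
  exact two_mul_card_of_involution hG hsurj'

theorem numPlanarIrr_of_le_one {n k : ℕ} (hk : k ≤ 1) :
    numPlanarIrr n k = if n = 1 ∧ k = 1 then 1 else 0 := by
  have hempty : (∀ p, ValidPair n p → irrSize n p ≠ k) → numPlanarIrr n k = 0 := fun h => by
    have : IsEmpty {p : LTree (Fin n) × LTree (Fin n) //
      ValidPair n p ∧ PlanarPair n p ∧ irrSize n p = k} := ⟨fun p => h p.1 p.2.1 p.2.2.2⟩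
    exact Nat.card_of_isEmpty (α := TangClass n fun p => irrSize n p = k)
  split_ifs with h
  · obtain ⟨rfl, rfl⟩ := h
    refine Nat.card_eq_one_iff_unique.2 ⟨⟨fun c d => ?_⟩, ⟨?_⟩⟩
    · obtain ⟨⟨p, hp⟩, rfl⟩ := Quot.exists_rep c
      obtain ⟨⟨q, hq⟩, rfl⟩ := Quot.exists_rep d
      have key : ∀ {t t' : LTree (Fin 1)}, t.leafList.Perm (List.finRange 1) →
          t'.leafList.Perm (List.finRange 1) → TreeRel id t t' := by
        intro t t' ht ht'
        obtain ⟨a, rfl⟩ := LTree.eq_leaf_of_length_le_one (by simpa using ht.length_eq.le)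
        obtain ⟨b, rfl⟩ := LTree.eq_leaf_of_length_le_one (by simpa using ht'.length_eq.le)
        rw [Subsingleton.elim b a]
        exact .rfl_id _
      exact TangClass.mk_eq_iff.2 ⟨id, key hp.1.1 hq.1.1, key hp.1.2 hq.1.2⟩
    · have hv : ValidPair 1 (.leaf 0, .leaf 0) := ⟨.refl _, .refl _⟩
      exact Quot.mk _ ⟨(.leaf 0, .leaf 0), hv,
        (planarPair_iff hv).2 ⟨_, .rfl_id _, .rfl_id _, rfl⟩, rfl⟩
  · refine hempty fun p hp hirr => ?_
    have hpos := p.1.leafList_length_pos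
    rw [hp.length] at hpos
    rcases Nat.lt_or_ge 1 n with hn | hn
    · have := (exists_decomposition hp hn hirr).1
      omega
    · rw [irrSize, if_pos hn] at hirr
      omega

end Counting

/-- The generating function identity
`T(x,y) = H(T(x), y) + T(x²) y² / 2 + x y`, stated coefficientwise: for all
`n, k`, the number `t_{n,k}` of planar tanglegrams of size `n` with
irreducible component of size `k` equals the coefficient of `x^n y^k` on the
right-hand side, namely
`ĥ_k · Σ_{a₁+⋯+a_k = n} t_{a₁} ⋯ t_{a_k} + [k = 2 ∧ n even] · t_{n/2} / 2 +
[n = 1 ∧ k = 1]`, where `ĥ_2 = 1/2` and `ĥ_k = h_k` for `k ≥ 3`. -/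
theorem tanglegram_generating_function (n k : ℕ) :
    (numPlanarIrr n k : ℚ) =
      hCoeff k *
          (∑ a ∈ Finset.Nat.antidiagonalTuple k n, ∏ i, (numPlanar (a i) : ℚ)) +
        (if k = 2 ∧ Even n then (numPlanar (n / 2) : ℚ) / 2 else 0) +
        (if n = 1 ∧ k = 1 then 1 else 0) := by
  rcases Nat.lt_or_ge k 2 with hk | hk
  · have hk2 : k ≠ 2 := by omega
    have hk3 : ¬ 3 ≤ k := by omega
    rw [numPlanarIrr_of_le_one (by omega)]
    simp [hCoeff, hk2, hk3]
  have hcard : (Nat.card (ClassTuple k n) : ℚ) =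
      ∑ a ∈ Finset.Nat.antidiagonalTuple k n, ∏ i, (numPlanar (a i) : ℚ) := by
    rw [card_classTuple]
    push_cast
    rfl
  rw [← hcard, if_neg (show ¬ (n = 1 ∧ k = 1) by omega), add_zero]
  rcases hk.eq_or_lt with rfl | hk
  · have h := congrArg (Nat.cast : ℕ → ℚ) (two_mul_card_irr_two n)
    push_cast at h
    simp only [hCoeff, if_true, true_and]
    split_ifs at h ⊢ <;> linarith
  · rw [card_irr_of_three_le n hk, hCoeff, if_neg (by omega), if_pos (by omega),
      if_neg (show ¬ (k = 2 ∧ Even n) from fun h => absurd h.1 (by omega))]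
    push_cast
    ring
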